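/- For all t, w ∈ ℕ, the Treewidth problem has finite integer index on graphs of treewidth at most w: there exists a finite set 𝓡 of t-boundaried graphs such that every t-boundaried graph G whose underlying graph has treewidth at most w satisfies G ≡_{TW,t} R for some R ∈ 𝓡. -/

import Mathlib

/-- A `t`-boundaried graph: a finite simple graph with `t` distinguished vertices
labeled injectively by `1,…,t`. -/
structure BGraph (t : ℕ) : Type 1 where
  V : Type
  fin : Fintype V
  G : SimpleGraph V
  b : Fin t → V
  binj : Function.Injective b

/-- The underlying relation of the glued graph `G₁ ⊕ G₂`. -/
def glueAdj {t : ℕ} (G₁ G₂ : BGraph t) :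
    G₁.V ⊕ {v : G₂.V // v ∉ Set.range G₂.b} →
    G₁.V ⊕ {v : G₂.V // v ∉ Set.range G₂.b} → Prop
  | Sum.inl u, Sum.inl v =>
      G₁.G.Adj u v ∨ ∃ i j, u = G₁.b i ∧ v = G₁.b j ∧ G₂.G.Adj (G₂.b i) (G₂.b j)
  | Sum.inl u, Sum.inr v => ∃ i, u = G₁.b i ∧ G₂.G.Adj (G₂.b i) v.1
  | Sum.inr _, Sum.inl _ => False
  | Sum.inr u, Sum.inr v => G₂.G.Adj u.1 v.1

/-- The glued graph `G₁ ⊕ G₂`. -/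
def glue {t : ℕ} (G₁ G₂ : BGraph t) :
    SimpleGraph (G₁.V ⊕ {v : G₂.V // v ∉ Set.range G₂.b}) :=
  SimpleGraph.fromRel (glueAdj G₁ G₂)

/-- `tw(G) ≤ k`: there is a tree decomposition of `G` all of whose bags have at most
`k + 1` vertices. -/
def TreewidthLE {W : Type} (G : SimpleGraph W) (k : ℤ) : Prop :=
  ∃ (ι : Type) (T : SimpleGraph ι) (B : ι → Set W),
    T.IsTree ∧
    (∀ v, ∃ x, v ∈ B x) ∧
    (∀ u v, G.Adj u v → ∃ x, u ∈ B x ∧ v ∈ B x) ∧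
    (∀ v : W, (SimpleGraph.induce {x : ι | v ∈ B x} T).Connected) ∧
    (∀ x, ((B x).ncard : ℤ) ≤ k + 1)

/-- Equivalence of `t`-boundaried graphs for the Treewidth problem. -/
def TWEquiv {t : ℕ} (G₁ G₂ : BGraph t) : Prop :=
  ∃ Δ : ℤ, ∀ (H : BGraph t) (k : ℤ),
    TreewidthLE (glue G₁ H) k ↔ TreewidthLE (glue G₂ H) (k + Δ)

inductive TWD {W : Type} [DecidableEq W] (G : SimpleGraph W) (ok : Finset W → Prop) :
    Finset W → Finset W → Prop
  | leaf : TWD G ok ∅ ∅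
  | intro {X U : Finset W} (v : W) : TWD G ok X U → v ∉ X → v ∉ U → ok (insert v X) →
      TWD G ok (insert v X) U
  | forget {X U : Finset W} (v : W) : TWD G ok (insert v X) U → v ∉ X →
      (∀ u, G.Adj v u → u ∈ X ∪ U) → TWD G ok X (insert v U)
  | join {X U₁ U₂ : Finset W} : TWD G ok X U₁ → TWD G ok X U₂ → Disjoint U₁ U₂ →
      TWD G ok X (U₁ ∪ U₂)

namespace TWD

variable {W : Type} [DecidableEq W] {G : SimpleGraph W} {ok : Finset W → Prop}

theorem disj {X U : Finset W} (h : TWD G ok X U) : ∀ x, x ∈ X → x ∉ U := by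
  induction h with
  | leaf => simp
  | intro v _ h1 h2 _ ih => grind
  | forget v _ h1 h2 ih => grind
  | join _ _ h ih1 ih2 => grind

theorem nbr {X U : Finset W} (h : TWD G ok X U) : ∀ v ∈ U, ∀ u, G.Adj v u → u ∈ X ∨ u ∈ U := by
  induction h with
  | leaf => simp
  | intro v _ h1 h2 _ ih => grind
  | forget v _ h1 h2 ih => grind
  | join _ _ h ih1 ih2 => grind

theorem isOk (h0 : ok ∅) (hd : ∀ X Y, X ⊆ Y → ok Y → ok X) {X U : Finset W} (h : TWD G ok X U) :
    ok X := by
  induction h with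
  | leaf => exact h0
  | intro v _ h1 h2 h3 ih => exact h3
  | forget v _ h1 h2 ih => exact hd _ _ (Finset.subset_insert _ _) ih
  | join _ _ h ih1 ih2 => exact ih1

theorem mono {ok' : Finset W → Prop} (hk : ∀ X, ok X → ok' X) {X U : Finset W}
    (h : TWD G ok X U) : TWD G ok' X U := by
  induction h with
  | leaf => exact leaf
  | intro v _ h1 h2 h3 ih => exact intro v ih h1 h2 (hk _ h3)
  | forget v _ h1 h2 ih => exact forget v ih h1 h2
  | join _ _ h ih1 ih2 => exact join ih1 ih2 h

theorem intros (hd : ∀ X Y, X ⊆ Y → ok Y → ok X) {X U : Finset W} (h : TWD G ok X U)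
    (Z : Finset W) (hXZ : X ⊆ Z) (hZU : ∀ x ∈ Z, x ∉ U) (hZ : ok Z) : TWD G ok Z U := by
  have key : ∀ S : Finset W, X ∪ S ⊆ Z → TWD G ok (X ∪ S) U := by
    intro S
    induction S using Finset.induction_on with
    | empty => intro _; simpa using h
    | insert a S ha ih =>
      intro hs
      have h1 := ih (by grind)
      by_cases hax : a ∈ X ∪ S
      · have : X ∪ insert a S = X ∪ S := by grind
        rw [this]; exact h1
      · have : X ∪ insert a S = insert a (X ∪ S) := by grind
        rw [this]
        exact intro a h1 hax (hZU a (by grind)) (hd _ Z (by grind) hZ)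
  have := key Z (by grind)
  rwa [Finset.union_eq_right.2 hXZ] at this

theorem forgets {Z U : Finset W} (h : TWD G ok Z U) (X V : Finset W) (hXZ : X ⊆ Z)
    (hV : ∀ x, x ∈ V ↔ x ∈ U ∨ (x ∈ Z ∧ x ∉ X))
    (hn : ∀ v ∈ Z, v ∉ X → ∀ u, G.Adj v u → u ∈ Z ∨ u ∈ U) : TWD G ok X V := by
  have key : ∀ S : Finset W, S ⊆ Z → TWD G ok (Z \ S) (U ∪ S) ∨ ¬ (S ⊆ Z \ X) := by
    intro S
    induction S using Finset.induction_on with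
    | empty => intro _; left; simpa using h
    | insert a S ha ih =>
      intro hs
      by_cases hsx : insert a S ⊆ Z \ X
      · left
        have h1 := (ih (by grind)).resolve_right (by grind)
        have e1 : Z \ S = insert a (Z \ insert a S) := by grind
        have e2 : U ∪ insert a S = insert a (U ∪ S) := by grind
        rw [e1] at h1
        rw [e2]
        exact forget a h1 (by grind) (fun u hu => by have := hu.ne; grind)
      · right; exact hsx
  have := (key (Z \ X) (by grind)).resolve_right (by grind)
  have e1 : Z \ (Z \ X) = X := by grind
  have e2 : U ∪ (Z \ X) = V := by grind
  rwa [e1, e2] at this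

end TWD
namespace TWTrunc

variable {W : Type} [DecidableEq W]

/-- bag bound with bounded part in `A`. -/
def ok2 (A : Finset W) (m M : ℕ) (X : Finset W) : Prop := X.card ≤ m ∧ (X ∩ A).card ≤ M

theorem ok2_anti (A : Finset W) (m M : ℕ) : ∀ X Y, X ⊆ Y → ok2 A m M Y → ok2 A m M X := by
  intro X Y h ⟨h1, h2⟩
  exact ⟨(Finset.card_le_card h).trans h1,
    (Finset.card_le_card (Finset.inter_subset_inter_right h)).trans h2⟩

theorem card_split (A X : Finset W) : X.card = (X ∩ A).card + (X \ A).card :=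
  (Finset.card_inter_add_card_sdiff X A).symm

theorem card_out {A X Y : Finset W} (h : ∀ x, x ∉ A → (x ∈ Y ↔ x ∈ X)) :
    (Y \ A).card = (X \ A).card := by
  congr 1; grind

structure Low (G : SimpleGraph W) (A B : Finset W) (m M : ℕ) (X U Y V : Finset W) : Prop where
  der : TWD G (ok2 A m M) Y V
  outY : ∀ x, x ∉ A → (x ∈ Y ↔ x ∈ X)
  outV : ∀ x, x ∉ A → (x ∈ V ↔ x ∈ U)
  inV : ∀ x, x ∈ A → x ∈ V → x ∈ U
  inY : ∀ x, x ∈ A → x ∈ Y → x ∈ X ∨ x ∈ U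
  bX : ∀ x, x ∈ B → x ∈ X → x ∈ Y
  bU : ∀ x, x ∈ B → x ∈ U → x ∈ Y ∨ x ∈ V
  cX : (Y ∩ A).card ≤ (X ∩ A).card
  cB : (Y ∩ A).card ≤ (X ∩ B).card + (U ∩ B).card

structure Intf (G : SimpleGraph W) (A B : Finset W) (t : ℕ) (X U Y V : Finset W) : Prop where
  outY : ∀ x, x ∉ A → (x ∈ Y ↔ x ∈ X)
  outV : ∀ x, x ∉ A → (x ∈ V ↔ x ∈ U)
  inU : ∀ x, x ∈ A → x ∈ U → x ∈ V
  inX : ∀ x, x ∈ A → x ∈ X → x ∈ Y ∨ x ∈ V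
  bX : ∀ x, x ∈ B → x ∈ X → x ∈ Y
  bV : ∀ x, x ∈ B → (x ∈ V ↔ x ∈ U)
  dj : ∀ x, x ∈ Y → x ∉ V
  nb : ∀ v ∈ V, ∀ u, G.Adj v u → u ∈ Y ∨ u ∈ V
  cX : (Y ∩ A).card ≤ (X ∩ A).card
  cB : (Y ∩ A).card + (U ∩ B).card ≤ 2 * t

def Hub (G : SimpleGraph W) (A B : Finset W) (ok : Finset W → Prop) (w : ℕ) : Prop :=
  ∀ Z R : Finset W, TWD G ok Z ∅ → (∀ x ∈ R, x ∉ Z) → (∀ x ∈ R, x ∈ A ∧ x ∉ B) →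
    (∀ v ∈ R, ∀ u, G.Adj v u → u ∈ Z ∨ u ∈ R) →
    (∀ P, P ⊆ A → P.card ≤ w + 1 → ok (Z ∪ P)) → TWD G ok Z R

section
variable {G : SimpleGraph W} {A B : Finset W} {m t w : ℕ}

theorem hub_step (hB : B.card ≤ t) (hBA : B ⊆ A)
    (hub : Hub G A B (ok2 A m (3 * t + w + 1)) w) {X U Y V Y' V' : Finset W} (hfat : 3 * t + w + 1 + (X \ A).card ≤ m)
    (low : Low G A B m (3 * t + w + 1) X U Y' V')
    (hd : ∀ x, x ∈ X → x ∉ U)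
    (outY : ∀ x, x ∉ A → (x ∈ Y ↔ x ∈ X))
    (outV : ∀ x, x ∉ A → (x ∈ V ↔ x ∈ U))
    (inU : ∀ x, x ∈ A → x ∈ U → x ∈ V)
    (inX : ∀ x, x ∈ A → x ∈ X → x ∈ Y ∨ x ∈ V)
    (bX : ∀ x, x ∈ B → x ∈ X → x ∈ Y)
    (bV : ∀ x, x ∈ B → (x ∈ V ↔ x ∈ U))
    (dj : ∀ x, x ∈ Y → x ∉ V)
    (nb : ∀ v ∈ V, ∀ u, G.Adj v u → u ∈ Y ∨ u ∈ V)
    (cB : (Y ∩ A).card ≤ 2 * t) : TWD G (ok2 A m (3 * t + w + 1)) Y V := by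
  obtain ⟨l0, l1, l2, l3, l4, l5, l6, l7, l8⟩ := low
  have hanti := ok2_anti A m (3 * t + w + 1)
  have hY' : (Y' ∩ A).card ≤ t := by
    have : (X ∩ B).card + (U ∩ B).card ≤ B.card := by
      rw [← Finset.card_union_of_disjoint]
      · exact Finset.card_le_card (by grind)
      · rw [Finset.disjoint_left]; grind
    omega
  have hZA : ((Y ∪ Y') ∩ A).card ≤ 3 * t := by
    rw [Finset.union_inter_distrib_right]
    have := Finset.card_union_le (Y ∩ A) (Y' ∩ A)
    omega
  have hZo : ((Y ∪ Y') \ A).card = (X \ A).card := by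
    apply card_out; grind
  have nV' := l0.nbr
  have dV' := l0.disj
  have s1 : ∀ x ∈ Y ∪ Y', x ∉ V' := by
    intro x hx hv
    rw [Finset.mem_union] at hx
    have a1 := l1 x; have a2 := l2 x; have a3 := l3 x; have a4 := inU x; have a5 := dj x
    have a6 := outY x; have a7 := hd x; have a8 := dV' x
    clear * - a1 a2 a3 a4 a5 a6 a7 a8 hx hv
    by_cases h : x ∈ A <;> grind
  have s2 : ∀ x, x ∈ Y' → x ∉ Y → x ∈ V := by
    intro x hx hv
    have a1 := l1 x; have a2 := l4 x; have a3 := inX x; have a4 := inU x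
    have a6 := outY x
    clear * - a1 a2 a3 a4 a6 hx hv
    by_cases h : x ∈ A <;> grind
  have s3 : ∀ x, x ∈ V' → x ∈ V := by
    intro x hx
    have a1 := l2 x; have a2 := l3 x; have a3 := outV x; have a4 := inU x
    clear * - a1 a2 a3 a4 hx
    by_cases h : x ∈ A <;> grind
  have s4 : ∀ x ∈ (V \ V') \ Y', x ∈ A ∧ x ∉ B := by
    intro x hx
    simp only [Finset.mem_sdiff] at hx
    have a1 := l2 x; have a2 := l6 x; have a3 := outV x; have a4 := bV x
    clear * - a1 a2 a3 a4 hx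
    by_cases h : x ∈ A <;> grind
  clear l1 l2 l3 l4 l5 l6 inU outY outV inX bX bV hd
  have hok : ∀ P, P ⊆ A → P.card ≤ w + 1 → ok2 A m (3 * t + w + 1) ((Y ∪ Y') ∪ P) := by
    intro P hP hc
    have e1 : ((Y ∪ Y' ∪ P) \ A) = ((Y ∪ Y') \ A) := by grind
    have e2 : ((Y ∪ Y' ∪ P) ∩ A) = ((Y ∪ Y') ∩ A) ∪ P := by grind
    have e3 := Finset.card_union_le ((Y ∪ Y') ∩ A) P
    have e4 := card_split A (Y ∪ Y' ∪ P)
    rw [e1, e2] at e4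
    refine ⟨by omega, ?_⟩
    rw [e2]; omega
  have hokZ : ok2 A m (3 * t + w + 1) (Y ∪ Y') := by
    simpa using hok ∅ (by simp) (by simp)
  have d1 := l0.intros hanti (Y ∪ Y') Finset.subset_union_right s1 hokZ
  have d0 : TWD G (ok2 A m (3 * t + w + 1)) (Y ∪ Y') ∅ :=
    TWD.leaf.intros hanti _ (by simp) (by simp) hokZ
  have d2 : TWD G (ok2 A m (3 * t + w + 1)) (Y ∪ Y') ((V \ V') \ Y') := by
    apply hub _ _ d0 _ s4 _ hok
    · intro x
      have a := dj x
      clear * - a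
      grind
    · intro v hv u hu
      simp only [Finset.mem_sdiff, Finset.mem_union] at hv ⊢
      have h1 := nb v hv.1.1 u hu
      have h2 := nV' u
      have h3 : u ∈ V' → v ∈ Y' ∨ v ∈ V' := fun h => nV' u h v hu.symm
      clear * - h1 h3 hv
      grind
  have d3 := d1.join d2 (by
    rw [Finset.disjoint_left]; intro x
    clear * -
    grind)
  apply d3.forgets Y V Finset.subset_union_left
  · intro x
    have a1 := s2 x; have a2 := s3 x; have a3 := dj x
    clear * - a1 a2 a3
    grind
  · intro v hv hv' u hu
    rw [Finset.mem_union] at hv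
    have h1 := nb v (s2 v (hv.resolve_left hv') hv') u hu
    have h2 := s2 u
    clear * - h1 h2
    grind

def Good (G : SimpleGraph W) (A B : Finset W) (m t w : ℕ) (X U : Finset W) : Prop :=
  (TWD G (ok2 A m (3 * t + w + 1)) X U ∨
    ∀ Y V, Intf G A B t X U Y V → TWD G (ok2 A m (3 * t + w + 1)) Y V) ∧
  ∃ Y V, Low G A B m (3 * t + w + 1) X U Y V

theorem self_intf {X U : Finset W} (d : TWD G (fun X => X.card ≤ m) X U)
    (h : (X ∩ A).card + (U ∩ B).card ≤ 2 * t) : Intf G A B t X U X U :=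
  ⟨by grind, by grind, by grind, by grind, by grind, by grind, d.disj, d.nbr, le_rfl, h⟩

theorem Good.alpha {X U : Finset W} (d : TWD G (fun X => X.card ≤ m) X U)
    (g : Good G A B m t w X U) (h : (X ∩ A).card + (U ∩ B).card ≤ 2 * t) :
    TWD G (ok2 A m (3 * t + w + 1)) X U := by
  rcases g.1 with h1 | h1
  · exact h1
  · exact h1 _ _ (self_intf d h)

theorem Low.self {X U : Finset W} (d : TWD G (ok2 A m (3 * t + w + 1)) X U)
    (h : (X ∩ A).card ≤ (X ∩ B).card + (U ∩ B).card) :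
    Low G A B m (3 * t + w + 1) X U X U :=
  ⟨d, by grind, by grind, by grind, by grind, by grind, by grind, le_rfl, h⟩

theorem cardB (hB : B.card ≤ t) {X U : Finset W} (hd : ∀ x, x ∈ X → x ∉ U) :
    (X ∩ B).card + (U ∩ B).card ≤ t := by
  rw [← Finset.card_union_of_disjoint]
  · exact (Finset.card_le_card (by grind)).trans hB
  · rw [Finset.disjoint_left]; grind

theorem beta_join (hBA : B ⊆ A) (hA : ∀ u ∈ A, u ∉ B → ∀ v, G.Adj u v → v ∈ A)
    {X U₁ U₂ : Finset W} (hm : X.card ≤ m)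
    (hdU : ∀ x ∈ U₁, x ∉ U₂) (hd1 : ∀ x, x ∈ X → x ∉ U₁) (hd2 : ∀ x, x ∈ X → x ∉ U₂)
    (hF : 2 * t < (X ∩ A).card + (U₁ ∩ B).card)
    (h1 : ∀ Y V, Intf G A B t X U₁ Y V → TWD G (ok2 A m (3 * t + w + 1)) Y V)
    (h2 : ∃ Y V, Low G A B m (3 * t + w + 1) X U₂ Y V) (Y V : Finset W)
    (hi : Intf G A B t X (U₁ ∪ U₂) Y V) : TWD G (ok2 A m (3 * t + w + 1)) Y V := by
  obtain ⟨Y', V', l0, l1, l2, l3, l4, l5, l6, l7, l8⟩ := h2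
  obtain ⟨i1, i2, i3, i4, i5, i6, i7, i8, i9, i10⟩ := hi
  have hanti := ok2_anti A m (3 * t + w + 1)
  have nV' := l0.nbr
  have dV' := l0.disj
  have c1 : ((U₁ ∪ U₂) ∩ B).card = (U₁ ∩ B).card + (U₂ ∩ B).card := by
    rw [Finset.union_inter_distrib_right, Finset.card_union_of_disjoint]
    rw [Finset.disjoint_left]; grind
  have c2 : ((Y ∪ Y') ∩ A).card ≤ (Y ∩ A).card + (U₂ ∩ B).card := by
    have e : (Y ∪ Y') ∩ A = (Y ∩ A) ∪ ((Y' ∩ A) \ (X ∩ B)) := by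
      ext x
      have := i5 x
      grind
    rw [e]
    have e1 := Finset.card_union_le (Y ∩ A) ((Y' ∩ A) \ (X ∩ B))
    have e2 : X ∩ B ⊆ Y' ∩ A := by grind
    have e3 := Finset.card_sdiff_add_card_eq_card e2
    omega
  have c3 : ((Y ∪ Y') \ A).card = (X \ A).card := by
    apply card_out; grind
  have c4 := card_split A (Y ∪ Y')
  have c5 := card_split A X
  have hok : ok2 A m (3 * t + w + 1) (Y ∪ Y') := ⟨by omega, by omega⟩
  have d1 : TWD G (ok2 A m (3 * t + w + 1)) (Y ∪ Y') ((V \ V') \ Y') := by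
    apply h1
    refine ⟨by grind, ?_, by grind, by grind, by grind, by grind, by grind, ?_, by omega, by omega⟩
    · intro x hx
      grind
    · intro v hv u hu
      have h1 := i8 v (by grind) u hu
      have h2 := nV' u
      have := hu.symm
      grind
  have d2 := l0.intros hanti (Y ∪ Y') (by grind) (by
    intro x hx
    by_cases hx : x ∈ A <;> grind) hok
  have d3 := d1.join d2 (by rw [Finset.disjoint_left]; grind)
  apply d3.forgets Y V (by grind)
  · intro x
    by_cases hx : x ∈ A <;> grind
  · intro v hv hv' u hu
    have h1 := i8 v (by by_cases hx : v ∈ A <;> grind) u hu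
    grind

theorem main (hB : B.card ≤ t) (hBA : B ⊆ A) (hA : ∀ u ∈ A, u ∉ B → ∀ v, G.Adj u v → v ∈ A)
    (hub : Hub G A B (ok2 A m (3 * t + w + 1)) w) {X U : Finset W}
    (d : TWD G (fun X => X.card ≤ m) X U) : Good G A B m t w X U := by
  have hanti := ok2_anti A m (3 * t + w + 1)
  induction d with
  | leaf =>
    exact ⟨Or.inl .leaf, ∅, ∅, .leaf, by simp, by simp, by simp, by simp, by simp, by simp, by simp,
      by simp⟩
  | @intro X U v d h1 h2 h3 ih =>
    obtain ⟨hP, Y', V', low⟩ := ih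
    have low' := low
    obtain ⟨l0, l1, l2, l3, l4, l5, l6, l7, l8⟩ := low'
    have hdj := d.disj
    have hdn := d.nbr
    have hcs := card_split A (insert v X)
    constructor
    · by_cases hself : (insert v X ∩ A).card + (U ∩ B).card ≤ 2 * t
      · left
        have hle : (X ∩ A).card ≤ (insert v X ∩ A).card := Finset.card_le_card (by grind)
        have := Good.alpha d ⟨hP, Y', V', low⟩ (by omega)
        exact .intro v this h1 h2 ⟨h3, by omega⟩
      · rcases hP with hα | hβ
        · by_cases hf : (insert v X ∩ A).card ≤ 3 * t + w + 1
          · left; exact .intro v hα h1 h2 ⟨h3, hf⟩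
          · right
            intro Y V hi
            obtain ⟨i1, i2, i3, i4, i5, i6, i7, i8, i9, i10⟩ := hi
            have hvA : v ∈ A := by
              by_contra hvA
              apply hf
              have e : insert v X ∩ A = X ∩ A := by grind
              rw [e]
              have := (hα.isOk (by simp [ok2]) hanti).2
              exact this
            have e : (insert v X) \ A = X \ A := by grind
            rw [e] at hcs
            exact hub_step hB hBA hub (by omega) low hdj (by grind) i2 i3 (by grind) (by grind) i6 i7 i8
              (by omega)
        · right
          intro Y V hi
          obtain ⟨i1, i2, i3, i4, i5, i6, i7, i8, i9, i10⟩ := hi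
          by_cases hvA : v ∈ A
          · apply hβ
            have e : insert v X ∩ A = insert v (X ∩ A) := by grind
            rw [e, Finset.card_insert_of_notMem (by grind)] at hself
            exact ⟨by grind, i2, i3, by grind, by grind, i6, i7, i8, by omega, i10⟩
          · have e : insert v X ∩ A = X ∩ A := by grind
            have e2 : (Y.erase v) ∩ A = Y ∩ A := by grind
            have := hβ (Y.erase v) V ⟨by grind, i2, i3, by grind, by grind, i6, by grind, ?_,
              by rw [e2, ← e]; omega, by rw [e2]; omega⟩
            · have hvY : v ∈ Y := by grind
              have e3 : insert v (Y.erase v) = Y := Finset.insert_erase hvY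
              rw [← e3]
              apply TWD.intro v this (by grind) (by grind)
              rw [e3]
              have := card_split A Y
              have := card_out i1
              exact ⟨by omega, by omega⟩
            · intro z hz u hu
              have := i8 z hz u hu
              have h5 : u ≠ v := by
                rintro rfl
                by_cases hzA : z ∈ A
                · by_cases hzB : z ∈ B
                  · have := hdn z (by grind) u hu
                    grind
                  · exact hvA (hA z hzA hzB u hu)
                · have := hdn z (by grind) u hu
                  grind
              grind
    · have hcB := cardB hB hdj
      by_cases hvA : v ∈ A
      · by_cases hvB : v ∈ B
        · have e1 : insert v Y' ∩ A = insert v (Y' ∩ A) := by grind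
          have e2 : insert v X ∩ A = insert v (X ∩ A) := by grind
          have e3 : insert v X ∩ B = insert v (X ∩ B) := by grind
          have e4 : (insert v Y' ∩ A).card = (Y' ∩ A).card + 1 := by
            rw [e1, Finset.card_insert_of_notMem (by grind)]
          have e5 : (insert v X ∩ A).card = (X ∩ A).card + 1 := by
            rw [e2, Finset.card_insert_of_notMem (by grind)]
          have e6 : (insert v X ∩ B).card = (X ∩ B).card + 1 := by
            rw [e3, Finset.card_insert_of_notMem (by grind)]
          refine ⟨insert v Y', V', ?_, by grind, by grind, by grind, by grind, by grind, by grind,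
            by omega, by omega⟩
          have e7 : (insert v Y' \ A).card = (insert v X \ A).card := card_out (by grind)
          have e8 := card_split A (insert v Y')
          have e9 : (insert v Y' ∩ A).card ≤ t + 1 := by omega
          exact .intro v l0 (by grind) (by grind) ⟨by omega, by omega⟩
        · have hle : (X ∩ A).card ≤ (insert v X ∩ A).card := Finset.card_le_card (by grind)
          have hle2 : (X ∩ B).card ≤ (insert v X ∩ B).card := Finset.card_le_card (by grind)
          exact ⟨Y', V', l0, by grind, by grind, by grind, by grind, by grind, by grind, by omega,
            by omega⟩
      · have e1 : insert v Y' ∩ A = Y' ∩ A := by grind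
        have e2 : insert v X ∩ A = X ∩ A := by grind
        have e3 : insert v X ∩ B = X ∩ B := by grind
        refine ⟨insert v Y', V', ?_, by grind, by grind, by grind, by grind, by grind, by grind,
            by rw [e1, e2]; omega, by rw [e1, e3]; omega⟩
        have e7 : (insert v Y' \ A).card = (insert v X \ A).card := card_out (by grind)
        have e8 := card_split A (insert v Y')
        rw [e1] at e8
        rw [e2] at hcs
        exact .intro v l0 (by grind) (by grind) ⟨by omega, by rw [e1]; omega⟩
  | @forget X U v d h1 h2 ih =>
    have g := ih
    obtain ⟨hP, Y', V', low⟩ := ih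
    obtain ⟨l0, l1, l2, l3, l4, l5, l6, l7, l8⟩ := low
    have hdj := d.disj
    have hdn := d.nbr
    constructor
    · rcases hP with hα | hβ
      · left; exact .forget v hα h1 h2
      · right
        intro Y V hi
        obtain ⟨i1, i2, i3, i4, i5, i6, i7, i8, i9, i10⟩ := hi
        by_cases hvI : v ∈ A ∧ v ∉ B
        · apply hβ
          have hle : (X ∩ A).card ≤ (insert v X ∩ A).card := Finset.card_le_card (by grind)
          have hle2 : (U ∩ B).card ≤ (insert v U ∩ B).card := Finset.card_le_card (by grind)
          exact ⟨by grind, by grind, by grind, by grind, by grind, by grind, by grind, i8,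
            by omega, by omega⟩
        · have hvV : v ∈ V := by grind
          have hvY : v ∉ Y := by grind
          have := hβ (insert v Y) (V.erase v) ⟨by grind, by grind, by grind, by grind, by grind,
            by grind, by grind, by grind, ?_, ?_⟩
          · have e3 : insert v (V.erase v) = V := Finset.insert_erase hvV
            rw [← e3]
            refine .forget v this hvY ?_
            intro u hu
            have := i8 v hvV u hu
            have := hu.ne
            grind
          · by_cases hvA : v ∈ A
            · have e1 : insert v Y ∩ A = insert v (Y ∩ A) := by grind
              have e2 : insert v X ∩ A = insert v (X ∩ A) := by grind
              rw [e1, e2, Finset.card_insert_of_notMem (by grind),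
                Finset.card_insert_of_notMem (by grind)]
              omega
            · have e1 : insert v Y ∩ A = Y ∩ A := by grind
              have e2 : insert v X ∩ A = X ∩ A := by grind
              rw [e1, e2]; omega
          · by_cases hvA : v ∈ A
            · have e1 : insert v Y ∩ A = insert v (Y ∩ A) := by grind
              have e2 : insert v U ∩ B = insert v (U ∩ B) := by grind
              rw [e2, Finset.card_insert_of_notMem (by grind)] at i10
              rw [e1, Finset.card_insert_of_notMem (by grind)]
              omega
            · have e1 : insert v Y ∩ A = Y ∩ A := by grind
              have e2 : insert v U ∩ B = U ∩ B := by grind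
              rw [e2] at i10
              rw [e1]; omega
    · have hcB := cardB hB hdj
      by_cases hvA : v ∈ A
      · have e2 : insert v X ∩ A = insert v (X ∩ A) := by grind
        have e5 : (insert v X ∩ A).card = (X ∩ A).card + 1 := by
          rw [e2, Finset.card_insert_of_notMem (by grind)]
        have e6 : (insert v X ∩ B).card + (U ∩ B).card ≤ (X ∩ B).card + (insert v U ∩ B).card := by
          by_cases hvB : v ∈ B
          · have e1 : insert v X ∩ B = insert v (X ∩ B) := by grind
            have e2 : insert v U ∩ B = insert v (U ∩ B) := by grind
            rw [e1, e2, Finset.card_insert_of_notMem (by grind),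
                Finset.card_insert_of_notMem (by grind)]
            omega
          · have e1 : insert v X ∩ B = X ∩ B := by grind
            have e2 : insert v U ∩ B = U ∩ B := by grind
            rw [e1, e2]
        by_cases hc : (Y' ∩ A).card ≤ (X ∩ A).card
        · exact ⟨Y', V', l0, by grind, by grind, by grind, by grind, by grind, by grind, hc, by omega⟩
        · have := g.alpha d (by omega)
          exact ⟨X, insert v U, Low.self (.forget v this h1 h2) (by omega)⟩
      · have e1 : (Y'.erase v) ∩ A = Y' ∩ A := by grind
        have e2 : insert v X ∩ A = X ∩ A := by grind
        have e3 : insert v X ∩ B = X ∩ B := by grind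
        have e4 : insert v U ∩ B = U ∩ B := by grind
        rw [e2] at l7
        rw [e3] at l8
        refine ⟨Y'.erase v, insert v V', ?_, by grind, by grind, by grind, by grind, by grind,
          by grind, by rw [e1]; omega, by rw [e1, e4]; omega⟩
        have hvY : v ∈ Y' := by grind
        refine .forget v ?_ (by grind) ?_
        · rw [Finset.insert_erase hvY]; exact l0
        · intro u hu
          have h3 := h2 u hu
          have h4 := hu.ne
          have h5 := hA u
          have h6 := hu.symm
          by_cases huA : u ∈ A
          · have : u ∈ B := by
              by_contra hb
              exact hvA (h5 huA hb v h6)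
            grind
          · grind
  | @join X U₁ U₂ d1 d2 hdis ih1 ih2 =>
    have hdj1 := d1.disj
    have hdj2 := d2.disj
    rw [Finset.disjoint_left] at hdis
    have hm : X.card ≤ m := d1.isOk (by simp) (fun _ _ h h' => (Finset.card_le_card h).trans h')
    constructor
    · by_cases a1 : TWD G (ok2 A m (3 * t + w + 1)) X U₁
      · by_cases a2 : TWD G (ok2 A m (3 * t + w + 1)) X U₂
        · left; exact a1.join a2 (by rw [Finset.disjoint_left]; exact hdis)
        · right
          rw [Finset.union_comm]
          have hF : 2 * t < (X ∩ A).card + (U₂ ∩ B).card := by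
            by_contra hc
            exact a2 (ih2.alpha d2 (by omega))
          exact beta_join hBA hA hm (by grind) hdj2 hdj1 hF (ih2.1.resolve_left a2) ih1.2
      · right
        have hF : 2 * t < (X ∩ A).card + (U₁ ∩ B).card := by
          by_contra hc
          exact a1 (ih1.alpha d1 (by omega))
        exact beta_join hBA hA hm (by grind) hdj1 hdj2 hF (ih1.1.resolve_left a1) ih2.2
    · have hcB1 := cardB hB hdj1
      have hcB2 := cardB hB hdj2
      have c1 : ((U₁ ∪ U₂) ∩ B).card = (U₁ ∩ B).card + (U₂ ∩ B).card := by
        rw [Finset.union_inter_distrib_right, Finset.card_union_of_disjoint]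
        rw [Finset.disjoint_left]; grind
      have hcB := cardB (X := X) (U := U₁ ∪ U₂) hB (by grind)
      obtain ⟨Y₁, V₁, p0, p1, p2, p3, p4, p5, p6, p7, p8⟩ := ih1.2
      obtain ⟨Y₂, V₂, q0, q1, q2, q3, q4, q5, q6, q7, q8⟩ := ih2.2
      have c2 : ((Y₁ ∪ Y₂) ∩ A).card ≤ (X ∩ B).card + (U₁ ∩ B).card + (U₂ ∩ B).card := by
        have e : (Y₁ ∪ Y₂) ∩ A = (Y₁ ∩ A) ∪ ((Y₂ ∩ A) \ (X ∩ B)) := by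
          ext x
          have := p5 x
          grind
        rw [e]
        have e1 := Finset.card_union_le (Y₁ ∩ A) ((Y₂ ∩ A) \ (X ∩ B))
        have e2 : X ∩ B ⊆ Y₂ ∩ A := by grind
        have e3 := Finset.card_sdiff_add_card_eq_card e2
        omega
      by_cases hc : ((Y₁ ∪ Y₂) ∩ A).card ≤ (X ∩ A).card
      · have c3 : ((Y₁ ∪ Y₂) \ A).card = (X \ A).card := by
          apply card_out; grind
        have c4 := card_split A (Y₁ ∪ Y₂)
        have c5 := card_split A X
        have hok : ok2 A m (3 * t + w + 1) (Y₁ ∪ Y₂) := ⟨by omega, by omega⟩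
        have hV1 := p0.disj
        have hV2 := q0.disj
        have r1 := p0.intros hanti (Y₁ ∪ Y₂) (by grind) (by
          intro x hx
          by_cases hx : x ∈ A <;> grind) hok
        have r2 := q0.intros hanti (Y₁ ∪ Y₂) (by grind) (by
          intro x hx
          by_cases hx : x ∈ A <;> grind) hok
        have r3 := r1.join r2 (by
          rw [Finset.disjoint_left]
          intro x
          by_cases hx : x ∈ A <;> grind)
        exact ⟨_, _, r3, by grind, by grind, by grind, by grind, by grind, by grind, hc, by omega⟩
      · have a1 := ih1.alpha d1 (by omega)
        have a2 := ih2.alpha d2 (by omega)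
        exact ⟨_, _, Low.self (a1.join a2 (by rw [Finset.disjoint_left]; exact hdis)) (by omega)⟩

end

end TWTrunc
namespace TWTree

theorem reach_left {α β : Type} {K : SimpleGraph (α ⊕ β)} {K1 : SimpleGraph α}
    (h : ∀ a y, K.Adj (.inl a) y → ∃ b, y = .inl b ∧ K1.Adj a b) {a b : α}
    (hr : K.Reachable (.inl a) (.inl b)) : K1.Reachable a b := by
  obtain ⟨p⟩ := hr
  have key : ∀ (x y : α ⊕ β) (p : K.Walk x y) (a b : α), x = .inl a → y = .inl b →
      K1.Reachable a b := by
    intro x y p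
    induction p with
    | nil => rintro a b rfl h; cases h; exact .refl _
    | cons hadj _ ih =>
      rintro a b rfl rfl
      obtain ⟨c, rfl, hc⟩ := h _ _ hadj
      exact hc.reachable.trans (ih c b rfl rfl)
  exact key _ _ p _ _ rfl rfl

theorem reach_right {α β : Type} {K : SimpleGraph (α ⊕ β)} {K1 : SimpleGraph β}
    (h : ∀ a y, K.Adj (.inr a) y → ∃ b, y = .inr b ∧ K1.Adj a b) {a b : β}
    (hr : K.Reachable (.inr a) (.inr b)) : K1.Reachable a b := by
  obtain ⟨p⟩ := hr
  have key : ∀ (x y : α ⊕ β) (p : K.Walk x y) (a b : β), x = .inr a → y = .inr b →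
      K1.Reachable a b := by
    intro x y p
    induction p with
    | nil => rintro a b rfl h; cases h; exact .refl _
    | cons hadj _ ih =>
      rintro a b rfl rfl
      obtain ⟨c, rfl, hc⟩ := h _ _ hadj
      exact hc.reachable.trans (ih c b rfl rfl)
  exact key _ _ p _ _ rfl rfl

theorem sum_acyclic {α β : Type} {T1 : SimpleGraph α} {T2 : SimpleGraph β}
    (h1 : T1.IsAcyclic) (h2 : T2.IsAcyclic) : (SimpleGraph.sum T1 T2).IsAcyclic := by
  rw [SimpleGraph.isAcyclic_iff_forall_adj_isBridge] at *
  rintro (a | a) (b | b) hab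
  · have := h1 (SimpleGraph.sum_adj_inl.1 hab)
    rw [SimpleGraph.isBridge_iff] at *
    intro hr
    refine this (reach_left ?_ hr)
    rintro c (d | d) hd
    · simp at hd ⊢; exact hd
    · simp at hd
  · simp at hab
  · simp at hab
  · have := h2 (SimpleGraph.sum_adj_inr.1 hab)
    rw [SimpleGraph.isBridge_iff] at *
    intro hr
    refine this (reach_right ?_ hr)
    rintro c (d | d) hd
    · simp at hd
    · simp at hd ⊢; exact hd

/-- join two rooted trees. -/
def jt {α β : Type} (T1 : SimpleGraph α) (T2 : SimpleGraph β) (r1 : α) (r2 : β) :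
    SimpleGraph (α ⊕ β) := SimpleGraph.sum T1 T2 ⊔ SimpleGraph.edge (.inl r1) (.inr r2)

theorem jt_conn {α β : Type} {T1 : SimpleGraph α} {T2 : SimpleGraph β} {r1 : α} {r2 : β}
    {S : Set (α ⊕ β)}
    (h1 : (T1.induce {x | .inl x ∈ S}).Preconnected) (h2 : (T2.induce {x | .inr x ∈ S}).Preconnected)
    (hr : ∀ x y, .inl x ∈ S → .inr y ∈ S → .inl r1 ∈ S ∧ .inr r2 ∈ S) :
    ((jt T1 T2 r1 r2).induce S).Preconnected := by
  let f1 : (T1.induce {x | .inl x ∈ S}) →g ((jt T1 T2 r1 r2).induce S) :=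
    ⟨fun x => ⟨.inl x.1, x.2⟩, fun {a b} h => by
      simp only [SimpleGraph.comap_adj, jt, SimpleGraph.sup_adj] at h ⊢
      left; simpa using h⟩
  let f2 : (T2.induce {x | .inr x ∈ S}) →g ((jt T1 T2 r1 r2).induce S) :=
    ⟨fun x => ⟨.inr x.1, x.2⟩, fun {a b} h => by
      simp only [SimpleGraph.comap_adj, jt, SimpleGraph.sup_adj] at h ⊢
      left; simpa using h⟩
  have key : ∀ x y (hx : .inl x ∈ S) (hy : .inr y ∈ S),
      ((jt T1 T2 r1 r2).induce S).Reachable ⟨.inl x, hx⟩ ⟨.inr y, hy⟩ := by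
    intro x y hx hy
    obtain ⟨g1, g2⟩ := hr x y hx hy
    have e1 := (h1 ⟨x, hx⟩ ⟨r1, g1⟩).map f1
    have e2 := (h2 ⟨r2, g2⟩ ⟨y, hy⟩).map f2
    refine e1.trans (SimpleGraph.Reachable.trans ?_ e2)
    apply SimpleGraph.Adj.reachable
    change (jt T1 T2 r1 r2).Adj (.inl r1) (.inr r2)
    simp [jt, SimpleGraph.edge_adj]
  rintro ⟨x | x, hx⟩ ⟨y | y, hy⟩
  · exact (h1 ⟨x, hx⟩ ⟨y, hy⟩).map f1
  · exact key _ _ _ _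
  · exact (key _ _ _ _).symm
  · exact (h2 ⟨x, hx⟩ ⟨y, hy⟩).map f2

theorem jt_tree {α β : Type} {T1 : SimpleGraph α} {T2 : SimpleGraph β} {r1 : α} {r2 : β}
    (h1 : T1.IsTree) (h2 : T2.IsTree) : (jt T1 T2 r1 r2).IsTree := by
  constructor
  · have : Nonempty (α ⊕ β) := ⟨.inl r1⟩
    refine ⟨?_⟩
    let f1 : T1 →g (jt T1 T2 r1 r2) :=
      ⟨fun x => .inl x, fun {a b} h => by
        simp only [jt, SimpleGraph.sup_adj] at h ⊢
        left; simpa using h⟩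
    let f2 : T2 →g (jt T1 T2 r1 r2) :=
      ⟨fun x => .inr x, fun {a b} h => by
        simp only [jt, SimpleGraph.sup_adj] at h ⊢
        left; simpa using h⟩
    have key : ∀ x y, (jt T1 T2 r1 r2).Reachable (.inl x) (.inr y) := by
      intro x y
      have e1 := (h1.1.preconnected x r1).map f1
      have e2 := (h2.1.preconnected r2 y).map f2
      refine e1.trans (SimpleGraph.Reachable.trans ?_ e2)
      apply SimpleGraph.Adj.reachable
      change (jt T1 T2 r1 r2).Adj (.inl r1) (.inr r2)
      simp [jt, SimpleGraph.edge_adj]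
    rintro (x | x) (y | y)
    · exact (h1.1.preconnected x y).map f1
    · exact key _ _
    · exact (key _ _).symm
    · exact (h2.1.preconnected x y).map f2
  · exact (sum_acyclic h1.2 h2.2).sup_edge_of_not_reachable (SimpleGraph.not_reachable_sum_inl_inr _ _)

structure RT {W : Type} [DecidableEq W] (G : SimpleGraph W) (m : ℕ) (X U : Finset W)
    (ι : Type) (T : SimpleGraph ι) (B : ι → Finset W) (r : ι) : Prop where
  tree : T.IsTree
  root : B r = X
  card : ∀ x, (B x).card ≤ m
  sub : ∀ x, B x ⊆ X ∪ U
  cov : ∀ v ∈ U, ∃ x, v ∈ B x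
  edge : ∀ v ∈ U, ∀ u, G.Adj v u → ∃ x, v ∈ B x ∧ u ∈ B x
  conn : ∀ v, (T.induce {x | v ∈ B x}).Preconnected

theorem RT.single {W : Type} [DecidableEq W] (G : SimpleGraph W) (m : ℕ) (X : Finset W)
    (h : X.card ≤ m) : RT G m X ∅ Unit ⊥ (fun _ => X) () where
  tree := ⟨⟨fun _ _ => .refl _⟩, SimpleGraph.isAcyclic_bot⟩
  root := rfl
  card := fun _ => h
  sub := by simp
  cov := by simp
  edge := by simp
  conn := by
    rintro v ⟨x, hx⟩ ⟨y, hy⟩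
    exact .refl _

theorem RT.of {W : Type} [DecidableEq W] {G : SimpleGraph W} {m : ℕ} {X U : Finset W}
    (d : TWD G (fun X => X.card ≤ m) X U) : ∃ ι T B r, RT G m X U ι T B r := by
  induction d with
  | leaf => exact ⟨_, _, _, _, RT.single G m ∅ (by simp)⟩
  | @intro X U v d h1 h2 h3 ih =>
    obtain ⟨ι, T, B, r, k⟩ := ih
    obtain ⟨k1, k2, k3, k4, k5, k6, k7⟩ := RT.single G m (insert v X) h3
    refine ⟨_, jt ⊥ T () r, Sum.elim (fun _ => insert v X) B, .inl (), jt_tree k1 k.tree, rfl, ?_, ?_,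
      ?_, ?_, ?_⟩
    · rintro (x | x)
      · exact h3
      · exact k.card x
    · rintro (x | x)
      · simp
      · have := k.sub x
        simp only [Sum.elim_inr]; grind
    · intro u hu
      obtain ⟨x, hx⟩ := k.cov u hu
      exact ⟨.inr x, hx⟩
    · intro u hu z hz
      obtain ⟨x, hx⟩ := k.edge u hu z hz
      exact ⟨.inr x, hx⟩
    · intro u
      refine jt_conn (k7 u) (k.conn u) ?_
      intro x y hx hy
      have e1 := k.sub y
      have e2 := d.disj u
      have e3 := k.root
      simp only [Set.mem_ofPred_eq, Sum.elim_inl, Sum.elim_inr] at hx hy ⊢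
      rw [e3]
      have := e1 hy
      grind
  | @forget X U v d h1 h2 ih =>
    obtain ⟨ι, T, B, r, k⟩ := ih
    have hc : X.card ≤ m := by
      have := k.card r
      rw [k.root] at this
      exact (Finset.card_le_card (Finset.subset_insert _ _)).trans this
    obtain ⟨k1, k2, k3, k4, k5, k6, k7⟩ := RT.single G m X hc
    refine ⟨_, jt ⊥ T () r, Sum.elim (fun _ => X) B, .inl (), jt_tree k1 k.tree, rfl, ?_, ?_,
      ?_, ?_, ?_⟩
    · rintro (x | x)
      · exact hc
      · exact k.card x
    · rintro (x | x)
      · simp only [Sum.elim_inl]; grind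
      · have := k.sub x
        simp only [Sum.elim_inr]; grind
    · intro u hu
      rw [Finset.mem_insert] at hu
      rcases hu with rfl | hu
      · exact ⟨.inr r, by simp [k.root]⟩
      · obtain ⟨x, hx⟩ := k.cov u hu
        exact ⟨.inr x, hx⟩
    · intro u hu z hz
      rw [Finset.mem_insert] at hu
      rcases hu with rfl | hu
      · have := h2 z hz
        rw [Finset.mem_union] at this
        rcases this with h | h
        · exact ⟨.inr r, by simp [k.root], by simp [k.root, h]⟩
        · obtain ⟨x, hx⟩ := k.edge z h u hz.symm
          exact ⟨.inr x, hx.symm⟩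
      · obtain ⟨x, hx⟩ := k.edge u hu z hz
        exact ⟨.inr x, hx⟩
    · intro u
      refine jt_conn (k7 u) (k.conn u) ?_
      intro x y hx hy
      have e3 := k.root
      simp only [Set.mem_ofPred_eq, Sum.elim_inl, Sum.elim_inr] at hx hy ⊢
      rw [e3]
      grind
  | @join X U₁ U₂ d1 d2 hdis ih1 ih2 =>
    obtain ⟨ι, T, B, r, k⟩ := ih1
    obtain ⟨ι', T', B', r', k'⟩ := ih2
    refine ⟨_, jt T T' r r', Sum.elim B B', .inl r, jt_tree k.tree k'.tree, k.root, ?_, ?_,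
      ?_, ?_, ?_⟩
    · rintro (x | x)
      · exact k.card x
      · exact k'.card x
    · rintro (x | x)
      · have := k.sub x
        simp only [Sum.elim_inl]; grind
      · have := k'.sub x
        simp only [Sum.elim_inr]; grind
    · intro u hu
      rw [Finset.mem_union] at hu
      rcases hu with hu | hu
      · obtain ⟨x, hx⟩ := k.cov u hu
        exact ⟨.inl x, hx⟩
      · obtain ⟨x, hx⟩ := k'.cov u hu
        exact ⟨.inr x, hx⟩
    · intro u hu z hz
      rw [Finset.mem_union] at hu
      rcases hu with hu | hu
      · obtain ⟨x, hx⟩ := k.edge u hu z hz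
        exact ⟨.inl x, hx⟩
      · obtain ⟨x, hx⟩ := k'.edge u hu z hz
        exact ⟨.inr x, hx⟩
    · intro u
      refine jt_conn (k.conn u) (k'.conn u) ?_
      intro x y hx hy
      have e1 := k.sub x
      have e2 := k'.sub y
      rw [Finset.disjoint_left] at hdis
      simp only [Set.mem_ofPred_eq, Sum.elim_inl, Sum.elim_inr] at hx hy ⊢
      rw [k.root, k'.root]
      have e3 := e1 hx
      have e4 := e2 hy
      have := @hdis u
      grind

theorem tw_of_twd {W : Type} [DecidableEq W] [Fintype W] {G : SimpleGraph W} {m : ℕ}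
    (d : TWD G (fun X => X.card ≤ m) ∅ Finset.univ) : TreewidthLE G ((m : ℤ) - 1) := by
  obtain ⟨ι, T, B, r, k⟩ := RT.of d
  refine ⟨ι, T, fun x => ↑(B x), k.tree, ?_, ?_, ?_, ?_⟩
  · intro v
    obtain ⟨x, hx⟩ := k.cov v (by simp)
    exact ⟨x, by simpa using hx⟩
  · intro u v huv
    obtain ⟨x, hx⟩ := k.edge u (by simp) v huv
    exact ⟨x, by simpa using hx⟩
  · intro v
    obtain ⟨x, hx⟩ := k.cov v (by simp)
    have : Nonempty {x : ι | v ∈ (↑(B x) : Set W)} := ⟨⟨x, by simpa using hx⟩⟩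
    exact ⟨k.conn v⟩
  · intro x
    rw [Set.ncard_coe_finset]
    have := k.card x
    omega

end TWTree
namespace TWTree

theorem elim {W ι : Type} [DecidableEq W] [Fintype W] {G : SimpleGraph W} {ok : Finset W → Prop}
    (hd : ∀ X Y, X ⊆ Y → ok Y → ok X)
    (b : ι → Finset W) (hb : ∀ x, ok (b x)) (r : ι) (d : ι → ℕ) (par : ι → ι) (hr : d r = 0)
    (hpar : ∀ x, x ≠ r → d (par x) < d x)
    (key : ∀ v l x, v ∈ b l → v ∈ b x → x ≠ l → d x ≤ d l → l ≠ r → v ∈ b (par l)) (n : ℕ) :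
    ∀ (N : Finset ι) (A : ι → Finset W), N.card = n → r ∈ N → (∀ y ∈ N, y ≠ r → par y ∈ N) →
    (∀ x ∈ N, TWD G ok (b x) (A x)) →
    (∀ x ∈ N, ∀ y ∈ N, x ≠ y → ∀ v, v ∈ A x → v ∉ A y) →
    (∀ x ∈ N, ∀ y ∈ N, ∀ v, v ∈ A x → v ∉ b y) →
    (∀ v, ∃ x ∈ N, v ∈ b x ∨ v ∈ A x) →
    (∀ u v, G.Adj u v → (∃ x ∈ N, u ∈ b x ∧ v ∈ b x) ∨ ∃ x ∈ N, u ∈ A x ∨ v ∈ A x) →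
    TWD G ok ∅ Finset.univ := by
  classical
  induction n with
  | zero =>
    intro N A hN hrN
    rw [Finset.card_eq_zero] at hN
    subst hN; simp at hrN
  | succ n ih =>
    intro N A hN hrN hcl h1 h2 h3 h4 h5
    obtain ⟨l, hl, hmax⟩ := N.exists_max_image d ⟨r, hrN⟩
    by_cases hlr : l = r
    · have hall : ∀ x ∈ N, x = r := by
        intro x hx
        by_contra hxr
        have e1 := hmax x hx
        have e2 := hpar x hxr
        rw [hlr, hr] at e1
        omega
      have h4' : ∀ v, v ∈ b r ∨ v ∈ A r := by
        intro v
        obtain ⟨x, hx, hv⟩ := h4 v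
        rwa [hall x hx] at hv
      refine (h1 r hrN).forgets ∅ Finset.univ (by simp) ?_ ?_
      · intro x
        have := h4' x
        simp only [Finset.mem_univ, Finset.notMem_empty, not_false_eq_true, and_true, true_iff]
        exact this.symm
      · intro v _ _ u _
        exact h4' u
    · have hp := hcl l hl hlr
      have hdp := hpar l hlr
      set p := par l with hpdef
      have hpl : p ≠ l := by
        intro h; rw [h] at hdp; omega
      have hkey : ∀ v x, v ∈ b l → v ∈ b x → x ∈ N → x ≠ l → v ∈ b p := fun v x e1 e2 e3 e4 =>
        key v l x e1 e2 e4 (hmax x e3) hlr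
      have g1 : TWD G ok (b l ∩ b p) (A l ∪ (b l \ b p)) := by
        refine (h1 l hl).forgets _ _ Finset.inter_subset_left ?_ ?_
        · intro x
          clear * -
          grind
        · intro v hv hv' u hu
          have hvp : v ∉ b p := by
            intro h; exact hv' (Finset.mem_inter.2 ⟨hv, h⟩)
          rcases h5 v u hu with ⟨x, hx, e1, e2⟩ | ⟨x, hx, e | e⟩
          · by_cases hxl : x = l
            · rw [hxl] at e2; exact Or.inl e2
            · exact absurd (hkey v x hv e1 hx hxl) hvp
          · exact absurd hv (h3 x hx l hl v e)
          · by_cases hxl : x = l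
            · rw [hxl] at e; exact Or.inr e
            · rcases (h1 x hx).nbr u e v hu.symm with e3 | e3
              · exact absurd (hkey v x hv e3 hx hxl) hvp
              · exact absurd hv (h3 x hx l hl v e3)
      have g2 : TWD G ok (b p) (A l ∪ (b l \ b p)) := by
        refine g1.intros hd _ Finset.inter_subset_right ?_ (hb p)
        intro x hx hx'
        have := h3 l hl p hp x
        clear * - hx hx' this
        grind
      have g3 := (h1 p hp).join g2 (by
        rw [Finset.disjoint_left]
        intro x hx hx'
        have e1 := h2 p hp l hl hpl x hx
        have e2 := h3 p hp l hl x hx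
        clear * - e1 e2 hx'
        grind)
      refine ih (N.erase l) (Function.update A p (A p ∪ (A l ∪ (b l \ b p)))) ?_ ?_ ?_ ?_ ?_ ?_ ?_ ?_
      · rw [Finset.card_erase_of_mem hl]; omega
      · exact Finset.mem_erase.2 ⟨fun h => hlr h.symm, hrN⟩
      · intro y hy hyr
        rw [Finset.mem_erase] at hy ⊢
        refine ⟨?_, hcl y hy.2 hyr⟩
        intro h
        have e1 := hpar y hyr
        have e2 := hmax y hy.2
        rw [h] at e1; omega
      · intro x hx
        rw [Finset.mem_erase] at hx
        by_cases hxp : x = p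
        · rw [hxp, Function.update_self]; exact g3
        · rw [Function.update_of_ne hxp]; exact h1 x hx.2
      · have aux : ∀ y ∈ N.erase l, y ≠ p → ∀ v, v ∈ A p ∪ (A l ∪ (b l \ b p)) → v ∉ A y := by
          intro y hy hyp v hv hv'
          rw [Finset.mem_erase] at hy
          have e1 := h2 y hy.2 p hp hyp v hv'
          have e2 := h2 y hy.2 l hl hy.1 v hv'
          have e3 := h3 y hy.2 l hl v hv'
          clear * - e1 e2 e3 hv
          grind
        intro x hx y hy hxy v hv
        by_cases hxp : x = p
        · have hyp : y ≠ p := fun h => hxy (hxp.trans h.symm)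
          rw [hxp, Function.update_self] at hv
          rw [Function.update_of_ne hyp]
          exact aux y hy hyp v hv
        · rw [Function.update_of_ne hxp] at hv
          by_cases hyp : y = p
          · rw [hyp, Function.update_self]
            intro h
            exact aux x hx hxp v h hv
          · rw [Function.update_of_ne hyp]
            rw [Finset.mem_erase] at hx hy
            exact h2 x hx.2 y hy.2 hxy v hv
      · intro x hx y hy v hv
        rw [Finset.mem_erase] at hx hy
        by_cases hxp : x = p
        · rw [hxp, Function.update_self] at hv
          have e1 := h3 p hp y hy.2 v
          have e2 := h3 l hl y hy.2 v
          have e3 := fun h1 h2 => hkey v y h1 h2 hy.2 hy.1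
          clear * - e1 e2 e3 hv
          grind
        · rw [Function.update_of_ne hxp] at hv
          exact h3 x hx.2 y hy.2 v hv
      · intro v
        obtain ⟨x, hx, hv⟩ := h4 v
        by_cases hxl : x = l
        · refine ⟨p, Finset.mem_erase.2 ⟨hpl, hp⟩, ?_⟩
          rw [Function.update_self]
          rw [hxl] at hv
          clear * - hv
          grind
        · refine ⟨x, Finset.mem_erase.2 ⟨hxl, hx⟩, ?_⟩
          by_cases hxp : x = p
          · rw [hxp, Function.update_self]
            rw [hxp] at hv
            clear * - hv
            grind
          · rw [Function.update_of_ne hxp]; exact hv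
      · intro u v huv
        rcases h5 u v huv with ⟨x, hx, e1, e2⟩ | ⟨x, hx, e⟩
        · by_cases hxl : x = l
          · rw [hxl] at e1 e2
            by_cases hup : u ∈ b p
            · by_cases hvp : v ∈ b p
              · exact Or.inl ⟨p, Finset.mem_erase.2 ⟨hpl, hp⟩, hup, hvp⟩
              · right
                refine ⟨p, Finset.mem_erase.2 ⟨hpl, hp⟩, Or.inr ?_⟩
                rw [Function.update_self]
                simp [e2, hvp]
            · right
              refine ⟨p, Finset.mem_erase.2 ⟨hpl, hp⟩, Or.inl ?_⟩
              rw [Function.update_self]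
              simp [e1, hup]
          · exact Or.inl ⟨x, Finset.mem_erase.2 ⟨hxl, hx⟩, e1, e2⟩
        · right
          by_cases hxl : x = l
          · refine ⟨p, Finset.mem_erase.2 ⟨hpl, hp⟩, ?_⟩
            rw [Function.update_self]
            rw [hxl] at e
            clear * - e
            grind
          · refine ⟨x, Finset.mem_erase.2 ⟨hxl, hx⟩, ?_⟩
            by_cases hxp : x = p
            · rw [hxp, Function.update_self]
              rw [hxp] at e
              clear * - e
              grind
            · rw [Function.update_of_ne hxp]; exact e

theorem closure {ι : Type} (r : ι) (d : ι → ℕ) (par : ι → ι) (hpar : ∀ x, x ≠ r → d (par x) < d x)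
    (S : Finset ι) : ∃ N : Finset ι, S ⊆ N ∧ r ∈ N ∧ ∀ y ∈ N, y ≠ r → par y ∈ N := by
  classical
  have one : ∀ n x, d x ≤ n → ∃ N : Finset ι, x ∈ N ∧ r ∈ N ∧ ∀ y ∈ N, y ≠ r → par y ∈ N := by
    intro n
    induction n with
    | zero =>
      intro x hx
      have : x = r := by
        by_contra h
        have := hpar x h; omega
      exact ⟨{r}, by simp [this], by simp, by simp⟩
    | succ n ih =>
      intro x hx
      by_cases h : x = r
      · exact ⟨{r}, by simp [h], by simp, by simp⟩
      · have h1 := hpar x h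
        obtain ⟨N, e1, e2, e3⟩ := ih (par x) (by omega)
        refine ⟨insert x N, by simp, by simp [e2], ?_⟩
        intro y hy hyr
        rw [Finset.mem_insert] at hy ⊢
        rcases hy with rfl | hy
        · exact Or.inr e1
        · exact Or.inr (e3 y hy hyr)
  induction S using Finset.induction_on with
  | empty => exact ⟨{r}, by simp, by simp, by simp⟩
  | insert a S _ ih =>
    obtain ⟨N, e1, e2, e3⟩ := ih
    obtain ⟨N', e1', e2', e3'⟩ := one _ a le_rfl
    refine ⟨N ∪ N', ?_, by simp [e2], ?_⟩
    · intro x hx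
      rw [Finset.mem_insert] at hx
      rw [Finset.mem_union]
      rcases hx with rfl | hx
      · exact Or.inr e1'
      · exact Or.inl (e1 hx)
    · intro y hy hyr
      rw [Finset.mem_union] at hy ⊢
      rcases hy with hy | hy
      · exact Or.inl (e3 y hy hyr)
      · exact Or.inr (e3' y hy hyr)

theorem chain {ι : Type} {T : SimpleGraph ι} {r : ι} {d : ι → ℕ} {par : ι → ι}
    (hpar : ∀ x, x ≠ r → d (par x) < d x) (hadj : ∀ x, x ≠ r → T.Adj x (par x)) (l : ι) (n : ℕ) :
    ∀ x, d x ≤ n → x ≠ l → d x ≤ d l → ∃ p : T.Walk x r, l ∉ p.support := by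
  induction n with
  | zero =>
    intro x hx hxl _
    have : x = r := by
      by_contra h
      have := hpar x h; omega
    subst this
    exact ⟨.nil, by simpa using hxl.symm⟩
  | succ n ih =>
    intro x hx hxl hle
    by_cases h : x = r
    · subst h
      exact ⟨.nil, by simpa using hxl.symm⟩
    · have h1 := hpar x h
      obtain ⟨p, hp⟩ := ih (par x) (by omega) (by rintro h'; rw [h'] at h1; omega) (by omega)
      refine ⟨.cons (hadj x h) p, ?_⟩
      simp only [SimpleGraph.Walk.support_cons, List.mem_cons, not_or]
      exact ⟨hxl.symm, hp⟩

theorem unind {ι : Type} {T : SimpleGraph ι} {S : Set ι} {x y : S}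
    (q : (T.induce S).Walk x y) : ∃ q' : T.Walk x.1 y.1, ∀ z ∈ q'.support, z ∈ S := by
  induction q with
  | nil => exact ⟨.nil, by simp⟩
  | @cons x y _ h _ ih =>
    obtain ⟨q', hq⟩ := ih
    have h' : T.Adj x.1 y.1 := h
    refine ⟨.cons h' q', ?_⟩
    intro z hz
    rw [SimpleGraph.Walk.support_cons, List.mem_cons] at hz
    rcases hz with rfl | hz
    · exact x.2
    · exact hq z hz

theorem twd_of_tw {W : Type} [DecidableEq W] [Fintype W] {G : SimpleGraph W} {k : ℤ}
    (h : TreewidthLE G k) :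
    0 ≤ k + 1 ∧ TWD G (fun X => X.card ≤ (k + 1).toNat) ∅ Finset.univ := by
  classical
  obtain ⟨ι, T, B, hT, hc, he, hcon, hk⟩ := h
  obtain ⟨r⟩ := hT.1.nonempty
  have hk0 : 0 ≤ k + 1 := le_trans (by positivity) (hk r)
  refine ⟨hk0, ?_⟩
  have hex : ∀ x, ∃ p, x ≠ r → T.Adj x p ∧ T.dist r p < T.dist r x := by
    intro x
    by_cases hx : x = r
    · exact ⟨r, fun h => absurd hx h⟩
    · obtain ⟨p, hp⟩ := hT.1.exists_walk_length_eq_dist x r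
      cases p with
      | nil => exact absurd rfl hx
      | @cons _ y _ ha q =>
        refine ⟨y, fun _ => ⟨ha, ?_⟩⟩
        have := SimpleGraph.dist_le q
        rw [SimpleGraph.dist_comm, SimpleGraph.dist_comm (v := x), ← hp]
        simp only [SimpleGraph.Walk.length_cons]
        omega
  choose par hpar using hex
  have hp1 : ∀ x, x ≠ r → T.dist r (par x) < T.dist r x := fun x hx => (hpar x hx).2
  have hp2 : ∀ x, x ≠ r → T.Adj x (par x) := fun x hx => (hpar x hx).1
  choose c hcc using hc
  have he' : ∀ e : W × W, ∃ x, G.Adj e.1 e.2 → e.1 ∈ B x ∧ e.2 ∈ B x := by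
    intro e
    by_cases h : G.Adj e.1 e.2
    · obtain ⟨x, hx⟩ := he _ _ h
      exact ⟨x, fun _ => hx⟩
    · exact ⟨r, fun h' => absurd h' h⟩
  choose f hf using he'
  obtain ⟨N, hN1, hN2, hN3⟩ := closure r (T.dist r) par hp1
    (Finset.univ.image c ∪ Finset.univ.image f)
  have hbm : ∀ x v, v ∈ (Finset.univ.filter (· ∈ B x)) ↔ v ∈ B x := by simp
  refine elim (ok := fun X => X.card ≤ (k + 1).toNat)
    (fun _ _ h h' => (Finset.card_le_card h).trans h')
    (fun x => Finset.univ.filter (· ∈ B x)) ?_ r (T.dist r) par (by simp) hp1 ?_ N.card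
    N (fun _ => ∅) rfl hN2 hN3 ?_ (by simp) (by simp) ?_ ?_
  · intro x
    have := hk x
    have e : (B x).ncard = (Finset.univ.filter (· ∈ B x)).card := by
      rw [← Set.ncard_coe_finset]
      congr 1; ext v; simp
    rw [e] at this
    change (Finset.univ.filter (· ∈ B x)).card ≤ _
    omega
  · intro v l x hvl hvx hxl hdx hlr
    rw [hbm] at hvl hvx ⊢
    by_contra hvp
    obtain ⟨q⟩ := (hcon v).preconnected ⟨l, hvl⟩ ⟨x, hvx⟩
    obtain ⟨q', hq'⟩ : ∃ q' : T.Walk l x, ∀ y ∈ q'.support, v ∈ B y := by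
      exact unind q
    obtain ⟨s1, hs1⟩ := chain hp1 hp2 l _ x le_rfl hxl hdx
    have hpl : par l ≠ l := (hp2 l hlr).ne.symm
    obtain ⟨s2, hs2⟩ := chain hp1 hp2 l _ (par l) le_rfl hpl (hp1 l hlr).le
    have hbr := (SimpleGraph.isAcyclic_iff_forall_adj_isBridge.1 hT.2) (hp2 l hlr)
    rw [SimpleGraph.isBridge_iff_forall_walk_mem_edges] at hbr
    have := hbr (q'.append (s1.append s2.reverse))
    rw [SimpleGraph.Walk.edges_append, SimpleGraph.Walk.edges_append, List.mem_append,
      List.mem_append, SimpleGraph.Walk.edges_reverse, List.mem_reverse] at this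
    rcases this with h | h | h
    · exact hvp (hq' _ (SimpleGraph.Walk.snd_mem_support_of_mem_edges _ h))
    · exact hs1 (SimpleGraph.Walk.fst_mem_support_of_mem_edges _ h)
    · exact hs2 (SimpleGraph.Walk.fst_mem_support_of_mem_edges _ h)
  · intro x _
    have := hk x
    have e : (B x).ncard = (Finset.univ.filter (· ∈ B x)).card := by
      rw [← Set.ncard_coe_finset]
      congr 1; ext v; simp
    rw [e] at this
    exact TWD.leaf.intros (fun _ _ h h' => (Finset.card_le_card h).trans h') _ (by simp) (by simp)
      (by omega)
  · intro v
    exact ⟨c v, hN1 (by simp), Or.inl (by rw [hbm]; exact hcc v)⟩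
  · intro u v huv
    left
    refine ⟨f (u, v), hN1 (by simp), ?_⟩
    simp only [hbm]
    exact hf (u, v) huv

end TWTree
noncomputable instance BGraph.decV {t : ℕ} (G : BGraph t) : DecidableEq G.V := Classical.decEq _
noncomputable instance BGraph.finV {t : ℕ} (G : BGraph t) : Fintype G.V := G.fin
/-- interior vertices. -/
abbrev BGraph.I {t : ℕ} (H : BGraph t) : Type := {v : H.V // v ∉ Set.range H.b}
noncomputable instance BGraph.finI {t : ℕ} (H : BGraph t) : Fintype H.I := Fintype.ofFinite _

namespace TWGlue

variable {t : ℕ}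

theorem ll (G H : BGraph t) (u v : G.V) : (glue G H).Adj (.inl u) (.inl v) ↔
    G.G.Adj u v ∨ ∃ i j, u = G.b i ∧ v = G.b j ∧ H.G.Adj (H.b i) (H.b j) := by
  simp only [glue, SimpleGraph.fromRel_adj, glueAdj]
  constructor
  · rintro ⟨_, h | (h | ⟨i, j, h1, h2, h3⟩)⟩
    · exact h
    · exact Or.inl h.symm
    · exact Or.inr ⟨j, i, h2, h1, h3.symm⟩
  · intro h
    refine ⟨?_, Or.inl h⟩
    intro e
    have e := Sum.inl_injective e
    rcases h with h | ⟨i, j, h1, h2, h3⟩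
    · exact h.ne e
    · apply h3.ne
      rw [h1, h2] at e
      rw [G.binj e]

theorem lr (G H : BGraph t) (u : G.V) (v : H.I) : (glue G H).Adj (.inl u) (.inr v) ↔
    ∃ i, u = G.b i ∧ H.G.Adj (H.b i) v.1 := by
  simp [glue, SimpleGraph.fromRel_adj, glueAdj]

theorem rl (G H : BGraph t) (u : G.V) (v : H.I) : (glue G H).Adj (.inr v) (.inl u) ↔
    ∃ i, u = G.b i ∧ H.G.Adj (H.b i) v.1 := by
  rw [SimpleGraph.adj_comm, lr]

theorem rr (G H : BGraph t) (u v : H.I) : (glue G H).Adj (.inr u) (.inr v) ↔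
    H.G.Adj u.1 v.1 := by
  simp only [glue, SimpleGraph.fromRel_adj, glueAdj]
  constructor
  · rintro ⟨_, h | h⟩
    · exact h
    · exact h.symm
  · intro h
    refine ⟨?_, Or.inl h⟩
    intro e
    have e := Sum.inr_injective e
    rw [e] at h
    exact h.ne rfl

/-- left part -/
noncomputable def lft (G H : BGraph t) : Finset (G.V ⊕ H.I) := Finset.univ.image Sum.inl
/-- boundary part -/
noncomputable def bdy (G H : BGraph t) : Finset (G.V ⊕ H.I) :=
  Finset.univ.image (fun i => Sum.inl (G.b i))

theorem hub (G H : BGraph t) (w : ℕ) (hG : TWD G.G (fun X => X.card ≤ w + 1) ∅ Finset.univ)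
    (ok : Finset (G.V ⊕ H.I) → Prop) : TWTrunc.Hub (glue G H) (lft G H) (bdy G H) ok w := by
  intro Z R d0 hRZ hRA hN hok
  have key : ∀ P Q, TWD G.G (fun X => X.card ≤ w + 1) P Q →
      TWD (glue G H) ok (Z ∪ (R ∩ P.image Sum.inl)) (R ∩ Q.image Sum.inl) := by
    intro P Q d
    induction d with
    | leaf => simpa using d0
    | @intro X U v d h1 h2 h3 ih =>
      by_cases hv : Sum.inl v ∈ R
      · have e : Z ∪ (R ∩ (insert v X).image Sum.inl) =
            insert (Sum.inl v) (Z ∪ (R ∩ X.image Sum.inl)) := by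
          rw [Finset.image_insert, Finset.inter_insert_of_mem hv, Finset.union_insert]
        have := hok (R ∩ (insert v X).image Sum.inl) (by
          intro x hx; exact (hRA x (Finset.mem_inter.1 hx).1).1)
          ((Finset.card_le_card Finset.inter_subset_right).trans (Finset.card_image_le.trans h3))
        rw [e] at this ⊢
        refine .intro _ ih ?_ ?_ this
        · have := hRZ _ hv
          simp [h1, this]
        · simp [h2]
      · have e : R ∩ (insert v X).image Sum.inl = R ∩ X.image Sum.inl := by
          rw [Finset.image_insert, Finset.inter_insert_of_notMem hv]
        rw [e]; exact ih
    | @forget X U v d h1 h2 ih =>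
      by_cases hv : Sum.inl v ∈ R
      · have e : Z ∪ (R ∩ (insert v X).image Sum.inl) =
            insert (Sum.inl v) (Z ∪ (R ∩ X.image Sum.inl)) := by
          rw [Finset.image_insert, Finset.inter_insert_of_mem hv, Finset.union_insert]
        have e2 : (R ∩ (insert v U).image Sum.inl) =
            insert (Sum.inl v) (R ∩ U.image Sum.inl) := by
          rw [Finset.image_insert, Finset.inter_insert_of_mem hv]
        rw [e] at ih
        rw [e2]
        refine .forget _ ih ?_ ?_
        · have := hRZ _ hv
          simp [h1, this]
        · intro u hu
          rcases hN _ hv u hu with h | h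
          · simp [h]
          · have hb := (hRA _ hv).2
            have hl := (hRA _ h).1
            simp only [lft, Finset.mem_image, Finset.mem_univ, true_and] at hl
            obtain ⟨u', rfl⟩ := hl
            rw [ll] at hu
            have : G.G.Adj v u' := by
              rcases hu with hu | ⟨i, j, h1, h2, h3⟩
              · exact hu
              · exfalso; apply hb
                simp only [bdy, Finset.mem_image, Finset.mem_univ, true_and]
                exact ⟨i, by rw [h1]⟩
            have := h2 u' this
            rw [Finset.mem_union] at this
            simp only [Finset.mem_union, Finset.mem_inter, h, Finset.mem_image, Sum.inl.injEq,
              exists_eq_right, true_and]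
            tauto
      · have e : R ∩ (insert v X).image Sum.inl = R ∩ X.image Sum.inl := by
          rw [Finset.image_insert, Finset.inter_insert_of_notMem hv]
        have e2 : R ∩ (insert v U).image Sum.inl = R ∩ U.image Sum.inl := by
          rw [Finset.image_insert, Finset.inter_insert_of_notMem hv]
        rw [e] at ih; rw [e2]; exact ih
    | @join X U₁ U₂ d1 d2 hdis ih1 ih2 =>
      rw [Finset.image_union, Finset.inter_union_distrib_left]
      refine ih1.join ih2 ?_
      rw [Finset.disjoint_left] at hdis ⊢
      rintro (x | x) hx hx'
      · simp only [Finset.mem_inter, Finset.mem_image, Sum.inl.injEq, exists_eq_right] at hx hx'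
        exact hdis hx.2 hx'.2
      · simp at hx
  have := key _ _ hG
  have e : R ∩ Finset.univ.image Sum.inl = R := by
    rw [Finset.inter_eq_left]
    intro x hx
    exact (hRA x hx).1
  rw [e] at this
  simpa using this

theorem trunc (G H : BGraph t) (w m : ℕ) (hG : TWD G.G (fun X => X.card ≤ w + 1) ∅ Finset.univ)
    (d : TWD (glue G H) (fun X => X.card ≤ m) ∅ Finset.univ) :
    TWD (glue G H) (fun X => X.card ≤ m ∧ X.toLeft.card ≤ 3 * t + w + 1) ∅ Finset.univ := by
  have hB : (bdy G H).card ≤ t := by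
    refine Finset.card_image_le.trans ?_
    simp
  have g := TWTrunc.main (A := lft G H) (B := bdy G H) (t := t) (w := w) hB
    (by
      intro x hx
      simp only [bdy, lft, Finset.mem_image, Finset.mem_univ, true_and] at hx ⊢
      obtain ⟨i, rfl⟩ := hx
      exact ⟨_, rfl⟩)
    (by
      rintro (u | u) hu hub (v | v) huv
      · simp [lft]
      · exfalso; apply hub
        rw [lr] at huv
        obtain ⟨i, rfl, _⟩ := huv
        simp [bdy]
      · simp [lft]
      · simp [lft] at hu) (hub G H w hG _) d
  have := TWTrunc.Good.alpha d g (by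
    simp only [Finset.empty_inter, Finset.card_empty, Finset.univ_inter]
    omega)
  refine this.mono ?_
  rintro X ⟨h1, h2⟩
  refine ⟨h1, le_trans ?_ h2⟩
  rw [← Finset.card_map (Function.Embedding.inl (α := G.V) (β := H.I))]
  apply Finset.card_le_card
  intro x hx
  rw [Finset.mem_map] at hx
  obtain ⟨y, hy, rfl⟩ := hx
  rw [Finset.mem_toLeft] at hy
  simp [lft, hy]

end TWGlue
namespace TWWord

structure Sys {α : Type*} [PartialOrder α] (cl : ℕ → α → α) : Prop where
  mono : ∀ c x y, x ≤ y → cl c x ≤ cl c y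
  up : ∀ c b x, c ≤ b → cl c x ≤ cl b x
  idem : ∀ b x, cl b (cl b x) = cl b x
  out : ∀ a c x, a ≤ c → cl a x ≤ cl c (cl a x)
  inn : ∀ a c x, a ≤ c → cl a x ≤ cl a (cl c x)

variable {α : Type*} {cl : ℕ → α → α}

/-- apply a word. -/
def wd (cl : ℕ → α → α) : List ℕ → α → α
  | [], x => x
  | c :: l, x => cl c (wd cl l x)

theorem wd_append (l l' : List ℕ) (x : α) : wd cl (l ++ l') x = wd cl l (wd cl l' x) := by
  induction l with
  | nil => rfl
  | cons c l ih => simp [wd, ih]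

/-- absorption. -/
def Abs (cl : ℕ → α → α) (lo hi a b : ℕ) : Prop :=
  ∀ l : List ℕ, (∀ c ∈ l, lo ≤ c ∧ c ≤ hi) → ∀ x, cl a (wd cl l (cl b x)) = cl a (cl b x)

theorem abs1 [PartialOrder α] (h : Sys cl) {a b : ℕ} : Abs cl a b b a := by
  intro l hl x
  induction l with
  | nil => rfl
  | cons c l ih =>
    have ih := ih (fun c hc => hl c (List.mem_cons_of_mem _ hc))
    obtain ⟨h1, h2⟩ := hl c (by simp)
    have key : ∀ l : List ℕ, (∀ c ∈ l, a ≤ c ∧ c ≤ b) → cl a x ≤ wd cl l (cl a x) := by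
      intro l hl
      induction l with
      | nil => exact le_rfl
      | cons c l ih =>
        have ih := ih (fun c hc => hl c (List.mem_cons_of_mem _ hc))
        obtain ⟨h1, h2⟩ := hl c (by simp)
        exact (h.out a c x h1).trans (h.mono c _ _ ih)
    apply le_antisymm
    · calc cl b (cl c (wd cl l (cl a x))) ≤ cl b (cl b (wd cl l (cl a x))) :=
            h.mono _ _ _ (h.up _ _ _ h2)
        _ = cl b (wd cl l (cl a x)) := h.idem _ _
        _ = _ := ih
    · exact h.mono _ _ _ (key _ hl)

theorem abs2 [PartialOrder α] (h : Sys cl) {a b : ℕ} : Abs cl a b a b := by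
  intro l hl x
  induction l with
  | nil => rfl
  | cons c l ih =>
    have ih := ih (fun c hc => hl c (List.mem_cons_of_mem _ hc))
    obtain ⟨h1, h2⟩ := hl c (by simp)
    have key : ∀ l : List ℕ, (∀ c ∈ l, a ≤ c ∧ c ≤ b) → wd cl l (cl b x) ≤ cl b x := by
      intro l hl
      induction l with
      | nil => exact le_rfl
      | cons c l ih =>
        have ih := ih (fun c hc => hl c (List.mem_cons_of_mem _ hc))
        obtain ⟨h1, h2⟩ := hl c (by simp)
        calc cl c (wd cl l (cl b x)) ≤ cl c (cl b x) := h.mono _ _ _ ih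
          _ ≤ cl b (cl b x) := h.up _ _ _ h2
          _ = cl b x := h.idem _ _
    apply le_antisymm
    · exact h.mono _ _ _ (key _ hl)
    · calc cl a (cl b x) = cl a (wd cl l (cl b x)) := ih.symm
        _ ≤ _ := h.inn a c _ h1

/-- words over an interval. -/
def Wds (cl : ℕ → α → α) (a n : ℕ) : Set (α → α) :=
  {f | ∃ l : List ℕ, (∀ c ∈ l, a ≤ c ∧ c < a + n) ∧ f = wd cl l}

theorem first_split (P : ℕ → Prop) (l : List ℕ) (h : ∃ x ∈ l, P x) :
    ∃ p e l', l = p ++ e :: l' ∧ P e ∧ ∀ x ∈ p, ¬ P x := by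
  induction l with
  | nil => simp at h
  | cons c l ih =>
    by_cases hc : P c
    · exact ⟨[], c, l, rfl, hc, by simp⟩
    · have : ∃ x ∈ l, P x := by
        obtain ⟨x, hx, hp⟩ := h
        rw [List.mem_cons] at hx
        rcases hx with rfl | hx
        · exact absurd hp hc
        · exact ⟨x, hx, hp⟩
      obtain ⟨p, e, l', e1, e2, e3⟩ := ih this
      refine ⟨c :: p, e, l', by rw [e1]; rfl, e2, ?_⟩
      intro x hx
      rw [List.mem_cons] at hx
      rcases hx with rfl | hx
      · exact hc
      · exact e3 x hx

theorem last_split (P : ℕ → Prop) (l : List ℕ) (h : ∃ x ∈ l, P x) :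
    ∃ s e q, l = s ++ e :: q ∧ P e ∧ ∀ x ∈ q, ¬ P x := by
  obtain ⟨p, e, l', e1, e2, e3⟩ := first_split P l.reverse (by simpa using h)
  refine ⟨l'.reverse, e, p.reverse, ?_, e2, by simpa using e3⟩
  rw [← List.reverse_reverse l, e1]
  simp

/-- the reduced words. -/
def Red (cl : ℕ → α → α) (Q : Set (α → α)) (a b : ℕ) : Set (α → α) :=
  (Set.image2 (fun p q => fun x => p (cl a (cl b (q x)))) Q Q) ∪
  (Set.image2 (fun p q => fun x => p (cl a (cl b (cl a (q x))))) Q Q)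

theorem reduce {lo hi a b : ℕ} (hab : Abs cl lo hi a b) (hba : Abs cl lo hi b a)
    (Q : Set (α → α)) (hQ : ∀ l : List ℕ, (∀ c ∈ l, lo ≤ c ∧ c ≤ hi) → (∀ c ∈ l, ¬ (c = a ∨ c = b)) →
      wd cl l ∈ Q) (p l : List ℕ) (hp : ∀ c ∈ p, lo ≤ c ∧ c ≤ hi) (hl : ∀ c ∈ l, lo ≤ c ∧ c ≤ hi)
      (hpe : ∀ c ∈ p, ¬ (c = a ∨ c = b)) (hb : b ∈ l) :
      wd cl (p ++ a :: l) ∈ Red cl Q a b := by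
  obtain ⟨r, s, rfl⟩ := List.append_of_mem hb
  have hr : ∀ c ∈ r, lo ≤ c ∧ c ≤ hi := fun c hc => hl c (by simp [hc])
  have hs : ∀ c ∈ s, lo ≤ c ∧ c ≤ hi := fun c hc => hl c (by simp [hc])
  by_cases hse : ∃ x ∈ s, (x = a ∨ x = b)
  · obtain ⟨s1, e, q, rfl, he, hq⟩ := last_split _ s hse
    have hs1 : ∀ c ∈ s1, lo ≤ c ∧ c ≤ hi := fun c hc => hs c (by simp [hc])
    have hq1 : ∀ c ∈ q, lo ≤ c ∧ c ≤ hi := fun c hc => hs c (by simp [hc])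
    rcases he with rfl | rfl
    · right
      refine ⟨_, hQ p hp hpe, _, hQ q hq1 hq, ?_⟩
      funext x
      rw [wd_append]
      simp only [wd, wd_append]
      rw [hab r hr, hba s1 hs1]
    · left
      refine ⟨_, hQ p hp hpe, _, hQ q hq1 hq, ?_⟩
      funext x
      have := hab (r ++ e :: s1) (by
        intro c hc
        simp only [List.mem_append, List.mem_cons] at hc
        rcases hc with h | rfl | h
        · exact hr c h
        · exact hl c (by simp)
        · exact hs1 c h) (wd cl q x)
      rw [wd_append]
      simp only [wd, wd_append] at this ⊢
      rw [this]
  · left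
    refine ⟨_, hQ p hp hpe, _, hQ s hs (fun c hc h => hse ⟨c, hc, h⟩), ?_⟩
    funext x
    rw [wd_append]
    simp only [wd, wd_append]
    rw [hab r hr]

theorem wds_finite [PartialOrder α] (h : Sys cl) (n : ℕ) : ∀ a, (Wds cl a n).Finite := by
  induction n using Nat.strong_induction_on with
  | _ n ih =>
    intro a
    rcases n with _ | _ | n
    · refine (Set.finite_singleton (wd cl [])).subset ?_
      rintro f ⟨l, hl, rfl⟩
      rcases l with _ | ⟨c, l⟩
      · rfl
      · have := hl c (by simp); omega
    · refine ((Set.finite_singleton (wd cl [a])).insert (wd cl [])).subset ?_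
      rintro f ⟨l, hl, rfl⟩
      have key : ∀ l : List ℕ, (∀ c ∈ l, a ≤ c ∧ c < a + 1) → wd cl (a :: l) = wd cl [a] := by
        intro l hl
        induction l with
        | nil => rfl
        | cons c l ih =>
          have h1 := ih (fun c hc => hl c (List.mem_cons_of_mem _ hc))
          have h2 := hl c (by simp)
          have : c = a := by omega
          subst this
          rw [← h1]
          funext x
          exact h.idem _ _
      rcases l with _ | ⟨c, l⟩
      · left; rfl
      · right
        have h2 := hl c (by simp)
        have : c = a := by omega
        subst this
        exact key l (fun c hc => hl c (List.mem_cons_of_mem _ hc))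
    · have f1 := ih (n + 1) (by omega) (a + 1)
      have f2 := ih (n + 1) (by omega) a
      have f3 := ih n (by omega) (a + 1)
      have f4 : ∀ x y, (Red cl (Wds cl (a + 1) n) x y).Finite := fun x y =>
        (f3.image2 _ f3).union (f3.image2 _ f3)
      refine (((f1.union f2).union (f4 a (a + n + 1))).union (f4 (a + n + 1) a)).subset ?_
      rintro f ⟨l, hl, rfl⟩
      by_cases ha : a ∈ l
      · by_cases hb : a + n + 1 ∈ l
        · obtain ⟨p, e, l', rfl, he, hp⟩ :=
            first_split (fun x => x = a ∨ x = a + n + 1) l ⟨a, ha, Or.inl rfl⟩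
          have hl' : ∀ c ∈ l', a ≤ c ∧ c ≤ a + n + 1 := by
            intro c hc
            have := hl c (by simp [hc])
            omega
          have hp' : ∀ c ∈ p, a ≤ c ∧ c ≤ a + n + 1 := by
            intro c hc
            have := hl c (by simp [hc])
            omega
          have hQ : ∀ l : List ℕ, (∀ c ∈ l, a ≤ c ∧ c ≤ a + n + 1) →
              (∀ c ∈ l, ¬ (c = a ∨ c = a + n + 1)) → wd cl l ∈ Wds cl (a + 1) n := by
            intro l h1 h2
            refine ⟨l, ?_, rfl⟩
            intro c hc
            have e1 := h1 c hc
            have e2 := h2 c hc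
            omega
          rcases he with rfl | rfl
          · left; right
            refine reduce (abs2 h) (abs1 h) _ hQ p l' hp' hl' hp ?_
            simp only [List.mem_append, List.mem_cons] at hb
            rcases hb with hb | hb | hb
            · exact absurd (Or.inr rfl) (hp _ hb)
            · omega
            · exact hb
          · right
            refine reduce (abs1 h) (abs2 h) _ (fun l h1 h2 => hQ l h1 (fun c hc => ?_)) p l' hp' hl'
              (fun c hc => ?_) ?_
            · have := h2 c hc; tauto
            · have := hp c hc; tauto
            · simp only [List.mem_append, List.mem_cons] at ha
              rcases ha with hb | hb | hb
              · exact absurd (Or.inl rfl) (hp _ hb)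
              · omega
              · exact hb
        · left; left; right
          refine ⟨l, ?_, rfl⟩
          intro c hc
          have := hl c hc
          have : c ≠ a + n + 1 := by rintro rfl; exact hb hc
          omega
      · left; left; left
        refine ⟨l, ?_, rfl⟩
        intro c hc
        have := hl c hc
        have : c ≠ a := by rintro rfl; exact ha hc
        omega

/-- closure of a set under letters `≤ M`. -/
def cls (cl : ℕ → α → α) (M : ℕ) (S : Set α) : Set α :=
  Set.image2 (fun f x => f x) (Wds cl 0 (M + 1)) S

theorem cls_finite [PartialOrder α] (h : Sys cl) (M : ℕ) {S : Set α} (hS : S.Finite) :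
    (cls cl M S).Finite := (wds_finite h _ _).image2 _ hS

theorem sub_cls {M : ℕ} {S : Set α} {x : α} (hx : x ∈ S) : x ∈ cls cl M S :=
  ⟨wd cl [], ⟨[], by simp, rfl⟩, x, hx, rfl⟩

theorem cl_mem_cls {M c : ℕ} (hc : c ≤ M) {S : Set α} {x : α} (hx : x ∈ cls cl M S) :
    cl c x ∈ cls cl M S := by
  obtain ⟨f, ⟨l, hl, rfl⟩, y, hy, rfl⟩ := hx
  refine ⟨wd cl (c :: l), ⟨c :: l, ?_, rfl⟩, y, hy, rfl⟩
  intro d hd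
  rw [List.mem_cons] at hd
  rcases hd with rfl | hd
  · omega
  · exact hl d hd

end TWWord

namespace TWFam

variable {t : ℕ}

/-- pendant pieces -/
def Pend (M : ℕ) (G : BGraph t) (C U : Finset G.V) : Prop :=
  TWD G.G (fun X => X.card ≤ M) C U ∧ ∀ i, G.b i ∉ U

/-- closure -/
inductive ClP (M : ℕ) (G : BGraph t) (c : ℕ) (S : Finset G.V → Finset G.V → Prop) :
    Finset G.V → Finset G.V → Prop
  | base {C U : Finset G.V} : S C U → C.card ≤ c → ClP M G c S C U
  | intro {C U : Finset G.V} (v : G.V) : ClP M G c S C U → v ∉ C → v ∉ U → v ∉ Set.range G.b →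
      (insert v C).card ≤ c → ClP M G c S (insert v C) U
  | forget {C U : Finset G.V} (v : G.V) : ClP M G c S (insert v C) U → v ∉ C →
      v ∉ Set.range G.b → (∀ u, G.G.Adj v u → u ∈ C ∪ U) → ClP M G c S C (insert v U)
  | pend {C U U₂ : Finset G.V} : ClP M G c S C U → Pend M G C U₂ → Disjoint U U₂ →
      ClP M G c S C (U ∪ U₂)

/-- families -/
abbrev Fam (t : ℕ) : Type 1 := (G : BGraph t) → Finset G.V → Finset G.V → Prop

/-- closure of families -/
def Cl (M : ℕ) (c : ℕ) (Φ : Fam t) : Fam t := fun G => ClP M G c (Φ G)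

theorem ClP.card_le {M : ℕ} {G : BGraph t} {c : ℕ} {S : Finset G.V → Finset G.V → Prop}
    {C U : Finset G.V} (h : ClP M G c S C U) : C.card ≤ c := by
  induction h with
  | base _ h => exact h
  | intro v _ _ _ _ h _ => exact h
  | forget v _ _ _ _ ih => exact (Finset.card_le_card (Finset.subset_insert _ _)).trans ih
  | pend _ _ _ ih => exact ih

theorem ClP.map {M : ℕ} {G : BGraph t} {c b : ℕ} (hcb : c ≤ b)
    {S S' : Finset G.V → Finset G.V → Prop}
    (hS : ∀ C U, C.card ≤ c → S C U → ClP M G b S' C U)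
    {C U : Finset G.V} (h : ClP M G c S C U) : ClP M G b S' C U := by
  induction h with
  | base h h' => exact hS _ _ h' h
  | intro v _ h1 h2 h3 h4 ih => exact .intro v ih h1 h2 h3 (h4.trans hcb)
  | forget v _ h1 h2 h3 ih => exact .forget v ih h1 h2 h3
  | pend _ h1 h2 ih => exact .pend ih h1 h2

theorem sys (M : ℕ) : TWWord.Sys (Cl (t := t) M) where
  mono c x y h G C U := ClP.map le_rfl (fun C U h1 h2 => .base (h G C U h2) h1)
  up c b x h G C U := ClP.map h (fun C U h1 h2 => .base h2 (h1.trans h))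
  idem b x := le_antisymm
    (fun G C U => ClP.map le_rfl (fun C U h1 h2 => h2))
    (fun G C U h => .base h h.card_le)
  out a c x h G C U h1 := .base h1 (h1.card_le.trans h)
  inn a c x h G C U := ClP.map le_rfl (fun C U h1 h2 => .base (.base h2 (h1.trans h)) h1)

/-- trace -/
noncomputable def tr (G : BGraph t) (U : Finset G.V) : Finset (Fin t) :=
  Finset.univ.filter (fun i => G.b i ∈ U)

theorem mem_tr {G : BGraph t} {U : Finset G.V} {i : Fin t} : i ∈ tr G U ↔ G.b i ∈ U := by
  simp [tr]

/-- base families -/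
def Base (M : ℕ) (τ : Finset (Fin t)) (c : ℕ) : Fam t := fun G C U =>
  Pend M G C U ∧ C.card ≤ c ∧ tr G C = τ

/-- introduce a boundary vertex -/
def IntroF (i : Fin t) (Φ : Fam t) : Fam t := fun G C' U =>
  ∃ C, C' = insert (G.b i) C ∧ Φ G C U ∧ G.b i ∉ C ∧ G.b i ∉ U

/-- forget a boundary vertex -/
def ForgetF (i : Fin t) (Φ : Fam t) : Fam t := fun G C U' =>
  ∃ U, U' = insert (G.b i) U ∧ Φ G (insert (G.b i) C) U ∧ G.b i ∉ C ∧
    ∀ u, G.G.Adj (G.b i) u → u ∈ C ∪ U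

/-- join -/
def JoinF (Φ₁ Φ₂ : Fam t) : Fam t := fun G C U =>
  ∃ U₁ U₂, U = U₁ ∪ U₂ ∧ Φ₁ G C U₁ ∧ Φ₂ G C U₂ ∧ Disjoint U₁ U₂

/-- levels -/
def Lev (t M : ℕ) : ℕ → Set (Fam t)
  | 0 => TWWord.cls (Cl M) M
      (Set.image2 (fun τ c => Base M τ c) Set.univ {c | c ≤ M})
  | n + 1 => TWWord.cls (Cl M) M (Lev t M n ∪
      Set.image2 (fun i Φ => IntroF i Φ) Set.univ (Lev t M n) ∪
      Set.image2 (fun i Φ => ForgetF i Φ) Set.univ (Lev t M n) ∪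
      Set.image2 JoinF (Lev t M n) (Lev t M n))

theorem lev_finite (M n : ℕ) : (Lev t M n).Finite := by
  induction n with
  | zero => exact TWWord.cls_finite (sys M) M (Set.finite_univ.image2 _ (Set.finite_le_nat M))
  | succ n ih =>
    refine TWWord.cls_finite (sys M) M ?_
    exact ((ih.union (Set.finite_univ.image2 _ ih)).union
      (Set.finite_univ.image2 _ ih)).union (ih.image2 _ ih)

theorem lev_mono (M : ℕ) {n n' : ℕ} (h : n ≤ n') : Lev t M n ⊆ Lev t M n' := by
  induction h with
  | refl => exact subset_rfl
  | step _ ih =>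
    intro x hx
    exact TWWord.sub_cls (Or.inl (Or.inl (Or.inl (ih hx))))

theorem lev_base {M c : ℕ} (hc : c ≤ M) (τ : Finset (Fin t)) (n : ℕ) : Base M τ c ∈ Lev t M n :=
  lev_mono M (Nat.zero_le n) (TWWord.sub_cls ⟨τ, trivial, c, hc, rfl⟩)

theorem lev_cl {M c n : ℕ} (hc : c ≤ M) {Φ : Fam t} (h : Φ ∈ Lev t M n) :
    Cl M c Φ ∈ Lev t M n := by
  cases n with
  | zero => exact TWWord.cl_mem_cls hc h
  | succ n => exact TWWord.cl_mem_cls hc h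

theorem lev_intro {M n : ℕ} {Φ : Fam t} (h : Φ ∈ Lev t M n) (i : Fin t) :
    IntroF i Φ ∈ Lev t M (n + 1) :=
  TWWord.sub_cls (Or.inl (Or.inl (Or.inr ⟨i, trivial, Φ, h, rfl⟩)))

theorem lev_forget {M n : ℕ} {Φ : Fam t} (h : Φ ∈ Lev t M n) (i : Fin t) :
    ForgetF i Φ ∈ Lev t M (n + 1) :=
  TWWord.sub_cls (Or.inl (Or.inr ⟨i, trivial, Φ, h, rfl⟩))

theorem lev_join {M n : ℕ} {Φ₁ Φ₂ : Fam t} (h₁ : Φ₁ ∈ Lev t M n) (h₂ : Φ₂ ∈ Lev t M n) :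
    JoinF Φ₁ Φ₂ ∈ Lev t M (n + 1) :=
  TWWord.sub_cls (Or.inr ⟨Φ₁, h₁, Φ₂, h₂, rfl⟩)

/-- closure preserves traces -/
theorem ClP.trace {M : ℕ} {G : BGraph t} {c : ℕ} {S : Finset G.V → Finset G.V → Prop}
    {σ τ : Finset (Fin t)} (hS : ∀ C U, S C U → tr G C = σ ∧ tr G U = τ)
    {C U : Finset G.V} (h : ClP M G c S C U) : tr G C = σ ∧ tr G U = τ := by
  have hi : ∀ v (Z : Finset G.V), v ∉ Set.range G.b → tr G (insert v Z) = tr G Z := by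
    intro v Z hv
    ext i
    rw [mem_tr, mem_tr, Finset.mem_insert]
    constructor
    · rintro (h | h)
      · exact absurd ⟨i, h⟩ hv
      · exact h
    · exact Or.inr
  induction h with
  | base h _ => exact hS _ _ h
  | intro v _ _ _ h _ ih => rwa [hi _ _ h]
  | forget v _ _ h _ ih => rw [hi _ _ h] at ih ⊢; exact ih
  | pend _ h _ ih =>
    refine ⟨ih.1, ?_⟩
    rw [← ih.2]
    ext i
    have := h.2 i
    simp [mem_tr, this]

theorem tr_insert {G : BGraph t} {v : G.V} (Z : Finset G.V) (hv : v ∉ Set.range G.b) :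
    tr G (insert v Z) = tr G Z := by
  ext i
  rw [mem_tr, mem_tr, Finset.mem_insert]
  constructor
  · rintro (h | h)
    · exact absurd ⟨i, h⟩ hv
    · exact h
  · exact Or.inr

theorem tr_insert_b {G : BGraph t} (i : Fin t) (Z : Finset G.V) :
    tr G (insert (G.b i) Z) = insert i (tr G Z) := by
  ext j
  simp [mem_tr, G.binj.eq_iff]

theorem tr_union {G : BGraph t} (Y Z : Finset G.V) : tr G (Y ∪ Z) = tr G Y ∪ tr G Z := by
  ext j
  simp [mem_tr]

theorem base_closed {M c : ℕ} (hc : c ≤ M) (τ : Finset (Fin t)) :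
    Cl M c (Base M τ c) ≤ Base M τ c := by
  intro G C U h
  have h' : ClP M G c (Base M τ c G) C U := h
  clear h
  induction h' with
  | base h _ => exact h
  | intro v _ h1 h2 h3 h4 ih =>
    obtain ⟨⟨d, hb⟩, hcard, ht⟩ := ih
    exact ⟨⟨.intro v d h1 h2 (h4.trans hc), hb⟩, h4, by rwa [tr_insert _ h3]⟩
  | forget v _ h1 h2 h3 ih =>
    obtain ⟨⟨d, hb⟩, hcard, ht⟩ := ih
    refine ⟨⟨.forget v d h1 h3, ?_⟩, ?_, by rwa [tr_insert _ h2] at ht⟩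
    · intro i hi
      rw [Finset.mem_insert] at hi
      rcases hi with hi | hi
      · exact h2 ⟨i, hi⟩
      · exact hb i hi
    · exact (Finset.card_le_card (Finset.subset_insert _ _)).trans hcard
  | pend _ h1 h2 ih =>
    obtain ⟨⟨d, hb⟩, hcard, ht⟩ := ih
    refine ⟨⟨.join d h1.1 h2, ?_⟩, hcard, ht⟩
    intro i hi
    rw [Finset.mem_union] at hi
    exact hi.elim (hb i) (h1.2 i)

end TWFam

namespace TWLink

open TWFam

variable {t : ℕ}

section ops

variable {G H : BGraph t} {ok : Finset (G.V ⊕ H.I) → Prop} {C U : Finset G.V} {Y V : Finset H.I}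

theorem insL (v : G.V) (C : Finset G.V) (Y : Finset H.I) :
    (insert v C).disjSum Y = insert (Sum.inl v) (C.disjSum Y) := by
  ext x; rcases x with x | x <;> simp

theorem insR (v : H.I) (C : Finset G.V) (Y : Finset H.I) :
    C.disjSum (insert v Y) = insert (Sum.inr v) (C.disjSum Y) := by
  ext x; rcases x with x | x <;> simp

theorem uni (U₁ U₂ : Finset G.V) (V₁ V₂ : Finset H.I) :
    (U₁ ∪ U₂).disjSum (V₁ ∪ V₂) = U₁.disjSum V₁ ∪ U₂.disjSum V₂ := by
  ext x; rcases x with x | x <;> simp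

theorem dIntroL (v : G.V) (d : TWD (glue G H) ok (C.disjSum Y) (U.disjSum V)) (h1 : v ∉ C)
    (h2 : v ∉ U) (h : ok ((insert v C).disjSum Y)) :
    TWD (glue G H) ok ((insert v C).disjSum Y) (U.disjSum V) := by
  rw [insL] at h ⊢
  exact .intro _ d (by simpa using h1) (by simpa using h2) h

theorem dIntroR (v : H.I) (d : TWD (glue G H) ok (C.disjSum Y) (U.disjSum V)) (h1 : v ∉ Y)
    (h2 : v ∉ V) (h : ok (C.disjSum (insert v Y))) :
    TWD (glue G H) ok (C.disjSum (insert v Y)) (U.disjSum V) := by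
  rw [insR] at h ⊢
  exact .intro _ d (by simpa using h1) (by simpa using h2) h

theorem dForgetL (v : G.V) (d : TWD (glue G H) ok ((insert v C).disjSum Y) (U.disjSum V))
    (h1 : v ∉ C) (hl : ∀ u, (glue G H).Adj (.inl v) (.inl u) → u ∈ C ∪ U)
    (hr : ∀ u, (glue G H).Adj (.inl v) (.inr u) → u ∈ Y ∪ V) :
    TWD (glue G H) ok (C.disjSum Y) ((insert v U).disjSum V) := by
  rw [insL] at d ⊢
  refine .forget _ d (by simpa using h1) ?_
  rintro (u | u) hu
  · simpa using hl u hu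
  · simpa using hr u hu

theorem dForgetR (v : H.I) (d : TWD (glue G H) ok (C.disjSum (insert v Y)) (U.disjSum V))
    (h1 : v ∉ Y) (hl : ∀ u, (glue G H).Adj (.inr v) (.inl u) → u ∈ C ∪ U)
    (hr : ∀ u, (glue G H).Adj (.inr v) (.inr u) → u ∈ Y ∪ V) :
    TWD (glue G H) ok (C.disjSum Y) (U.disjSum (insert v V)) := by
  rw [insR] at d ⊢
  refine .forget _ d (by simpa using h1) ?_
  rintro (u | u) hu
  · simpa using hl u hu
  · simpa using hr u hu

theorem dJoin {U₁ U₂ : Finset G.V} {V₁ V₂ : Finset H.I}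
    (d₁ : TWD (glue G H) ok (C.disjSum Y) (U₁.disjSum V₁))
    (d₂ : TWD (glue G H) ok (C.disjSum Y) (U₂.disjSum V₂)) (hU : Disjoint U₁ U₂)
    (hV : Disjoint V₁ V₂) : TWD (glue G H) ok (C.disjSum Y) ((U₁ ∪ U₂).disjSum (V₁ ∪ V₂)) := by
  rw [uni]
  refine .join d₁ d₂ ?_
  rw [Finset.disjoint_left] at hU hV ⊢
  rintro (u | u) hu
  · simpa using hU (by simpa using hu)
  · simpa using hV (by simpa using hu)

theorem dDisjL (d : TWD (glue G H) ok (C.disjSum Y) (U.disjSum V)) : ∀ x ∈ C, x ∉ U := by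
  intro x hx
  have := d.disj (.inl x) (by simpa using hx)
  simpa using this

theorem dDisjR (d : TWD (glue G H) ok (C.disjSum Y) (U.disjSum V)) : ∀ x ∈ Y, x ∉ V := by
  intro x hx
  have := d.disj (.inr x) (by simpa using hx)
  simpa using this

/-- induction -/
theorem dInd (P : Finset G.V → Finset H.I → Finset G.V → Finset H.I → Prop)
    (leaf : P ∅ ∅ ∅ ∅)
    (introL : ∀ (C U : Finset G.V) (Y V : Finset H.I) (v : G.V), P C Y U V → v ∉ C → v ∉ U →
      ok ((insert v C).disjSum Y) →
      TWD (glue G H) ok ((insert v C).disjSum Y) (U.disjSum V) → P (insert v C) Y U V)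
    (introR : ∀ (C U : Finset G.V) (Y V : Finset H.I) (v : H.I), P C Y U V → v ∉ Y → v ∉ V →
      ok (C.disjSum (insert v Y)) →
      TWD (glue G H) ok (C.disjSum (insert v Y)) (U.disjSum V) → P C (insert v Y) U V)
    (forgetL : ∀ (C U : Finset G.V) (Y V : Finset H.I) (v : G.V), P (insert v C) Y U V → v ∉ C →
      v ∉ U → TWD (glue G H) ok ((insert v C).disjSum Y) (U.disjSum V) → (∀ u, (glue G H).Adj (.inl v) (.inl u) → u ∈ C ∪ U) →
      (∀ u, (glue G H).Adj (.inl v) (.inr u) → u ∈ Y ∪ V) →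
      TWD (glue G H) ok (C.disjSum Y) ((insert v U).disjSum V) → P C Y (insert v U) V)
    (forgetR : ∀ (C U : Finset G.V) (Y V : Finset H.I) (v : H.I), P C (insert v Y) U V → v ∉ Y →
      v ∉ V → (∀ u, (glue G H).Adj (.inr v) (.inl u) → u ∈ C ∪ U) →
      (∀ u, (glue G H).Adj (.inr v) (.inr u) → u ∈ Y ∪ V) →
      TWD (glue G H) ok (C.disjSum Y) (U.disjSum (insert v V)) → P C Y U (insert v V))
    (join : ∀ (C U₁ U₂ : Finset G.V) (Y V₁ V₂ : Finset H.I), P C Y U₁ V₁ → P C Y U₂ V₂ →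
      TWD (glue G H) ok (C.disjSum Y) (U₁.disjSum V₁) →
      TWD (glue G H) ok (C.disjSum Y) (U₂.disjSum V₂) → Disjoint U₁ U₂ → Disjoint V₁ V₂ →
      P C Y (U₁ ∪ U₂) (V₁ ∪ V₂))
    (d : TWD (glue G H) ok (C.disjSum Y) (U.disjSum V)) : P C Y U V := by
  have key : ∀ X W, TWD (glue G H) ok X W → P X.toLeft X.toRight W.toLeft W.toRight := by
    intro X W d
    have td : ∀ {X W}, TWD (glue G H) ok X W →
        TWD (glue G H) ok (X.toLeft.disjSum X.toRight) (W.toLeft.disjSum W.toRight) := by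
      intro X W d
      rwa [Finset.toLeft_disjSum_toRight, Finset.toLeft_disjSum_toRight]
    induction d with
    | leaf =>
      have e1 : (∅ : Finset (G.V ⊕ H.I)).toLeft = ∅ := by ext; simp
      have e2 : (∅ : Finset (G.V ⊕ H.I)).toRight = ∅ := by ext; simp
      rw [e1, e2]; exact leaf
    | @intro X U v d h1 h2 h3 ih =>
      have d' := td (.intro v d h1 h2 h3)
      rw [← Finset.toLeft_disjSum_toRight (u := insert v X)] at h3
      rcases v with v | v
      · simp only [Finset.toLeft_insert_inl, Finset.toRight_insert_inl] at d' h3 ⊢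
        exact introL _ _ _ _ v ih (by simpa using h1) (by simpa using h2) h3 d'
      · simp only [Finset.toLeft_insert_inr, Finset.toRight_insert_inr] at d' h3 ⊢
        exact introR _ _ _ _ v ih (by simpa using h1) (by simpa using h2) h3 d'
    | @forget X U v d h1 h2 ih =>
      have d' := td (.forget v d h1 h2)
      have h3 := d.disj v (by simp)
      have d0 := td d
      rcases v with v | v
      · simp only [Finset.toLeft_insert_inl, Finset.toRight_insert_inl] at d' d0 ih ⊢
        refine forgetL _ _ _ _ v ih (by simpa using h1) (by simpa using h3) d0 ?_ ?_ d'
        · intro u hu; simpa using h2 _ hu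
        · intro u hu; simpa using h2 _ hu
      · simp only [Finset.toLeft_insert_inr, Finset.toRight_insert_inr] at d' ih ⊢
        refine forgetR _ _ _ _ v ih (by simpa using h1) (by simpa using h3) ?_ ?_ d'
        · intro u hu; simpa using h2 _ hu
        · intro u hu; simpa using h2 _ hu
    | @join X U₁ U₂ d1 d2 h ih1 ih2 =>
      rw [Finset.toLeft_union, Finset.toRight_union]
      rw [Finset.disjoint_left] at h
      refine join _ _ _ _ _ _ ih1 ih2 (td d1) (td d2) ?_ ?_
      · rw [Finset.disjoint_left]; intro a ha
        simpa using h (by simpa using ha)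
      · rw [Finset.disjoint_left]; intro a ha
        simpa using h (by simpa using ha)
  simpa using key _ _ d

end ops

/-- neighbours of an interior vertex -/
theorem int_ll {G H : BGraph t} {v : G.V} (hv : v ∉ Set.range G.b) {u : G.V}
    (h : (glue G H).Adj (.inl v) (.inl u)) : G.G.Adj v u := by
  rw [TWGlue.ll] at h
  rcases h with h | ⟨i, j, h1, _⟩
  · exact h
  · exact absurd ⟨i, h1.symm⟩ hv

theorem int_lr {G H : BGraph t} {v : G.V} (hv : v ∉ Set.range G.b) {u : H.I}
    (h : (glue G H).Adj (.inl v) (.inr u)) : False := by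
  rw [TWGlue.lr] at h
  obtain ⟨i, h1, _⟩ := h
  exact hv ⟨i, h1.symm⟩

theorem embed {G H : BGraph t} {M m : ℕ} (hM : M ≤ m) {C U : Finset G.V} (h : Pend M G C U)
    (Y : Finset H.I) (hY : C.card + Y.card ≤ m) :
    TWD (glue G H) (fun X => X.card ≤ m) (C.disjSum Y) (U.disjSum ∅) := by
  obtain ⟨d, hb⟩ := h
  have key : TWD (glue G H) (fun X => X.card ≤ m) (C.disjSum ∅) (U.disjSum ∅) := by
    clear hY
    induction d with
    | leaf => simpa using TWD.leaf
    | intro v d h1 h2 h3 ih =>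
      exact dIntroL v (ih hb) h1 h2 (by rw [Finset.card_disjSum]; simpa using h3.trans hM)
    | forget v d h1 h2 ih =>
      have hv : v ∉ Set.range G.b := by
        rintro ⟨i, rfl⟩; exact hb i (by simp)
      refine dForgetL v (ih (fun i hi => hb i (by simp [hi]))) h1 ?_ ?_
      · intro u hu; exact h2 u (int_ll hv hu)
      · intro u hu; exact (int_lr hv hu).elim
    | join d1 d2 h ih1 ih2 =>
      have := dJoin (ih1 (fun i hi => hb i (by simp [hi]))) (ih2 (fun i hi => hb i (by simp [hi])))
        h (Finset.disjoint_empty_left _)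
      simpa using this
  refine key.intros (fun X Y h h' => (Finset.card_le_card h).trans h') _
    (Finset.disjSum_mono_right _ (Finset.empty_subset _)) ?_ (by rwa [Finset.card_disjSum])
  rintro (x | x) hx
  · have := dDisjL key x (by simpa using hx)
    simpa using this
  · simp

/-- soundness of closure -/
theorem sound_cl {G H : BGraph t} {M m c : ℕ} (hM : M ≤ m) {Y V : Finset H.I}
    (hc : c + Y.card ≤ m) {S : Finset G.V → Finset G.V → Prop}
    (hS : ∀ C U, S C U → C.card ≤ c →
      TWD (glue G H) (fun X => X.card ≤ m) (C.disjSum Y) (U.disjSum V))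
    {C U : Finset G.V} (h : ClP M G c S C U) :
    TWD (glue G H) (fun X => X.card ≤ m) (C.disjSum Y) (U.disjSum V) := by
  induction h with
  | base h h' => exact hS _ _ h h'
  | intro v _ h1 h2 h3 h4 ih =>
    exact dIntroL v ih h1 h2 (by rw [Finset.card_disjSum]; omega)
  | forget v _ h1 hv h2 ih =>
    refine dForgetL v ih h1 ?_ ?_
    · intro u hu; exact h2 u (int_ll hv hu)
    · intro u hu; exact (int_lr hv hu).elim
  | pend h0 h1 h2 ih =>
    have := dJoin ih (embed hM h1 Y (by have := h0.card_le; omega)) h2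
      (Finset.disjoint_empty_right _)
    simpa using this

/-- the truncated bag predicate -/
abbrev okT (G H : BGraph t) (m M : ℕ) : Finset (G.V ⊕ H.I) → Prop :=
  fun X => X.card ≤ m ∧ X.toLeft.card ≤ M

theorem okT_iff {G H : BGraph t} {m M : ℕ} {C : Finset G.V} {Y : Finset H.I} :
    okT G H m M (C.disjSum Y) ↔ C.card + Y.card ≤ m ∧ C.card ≤ M := by
  simp [okT]

theorem okT_of {G H : BGraph t} {m M : ℕ} {C U : Finset G.V} {Y V : Finset H.I}
    (d : TWD (glue G H) (okT G H m M) (C.disjSum Y) (U.disjSum V)) :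
    C.card + Y.card ≤ m ∧ C.card ≤ M := by
  rw [← okT_iff (G := G) (H := H)]
  have e1 : (∅ : Finset (G.V ⊕ H.I)).toLeft = ∅ := by ext; simp
  refine d.isOk (by simp [okT, e1]) ?_
  intro X Y h h'
  exact ⟨(Finset.card_le_card h).trans h'.1,
    (Finset.card_le_card (Finset.toLeft_subset_toLeft h)).trans h'.2⟩

/-- no boundary vertex forgotten: left part. -/
theorem L0a {G H : BGraph t} {m M : ℕ} {C U : Finset G.V} {Y V : Finset H.I}
    (d : TWD (glue G H) (okT G H m M) (C.disjSum Y) (U.disjSum V)) (hb : ∀ i, G.b i ∉ U) :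
    Pend M G C U := by
  refine ⟨?_, hb⟩
  revert hb
  refine dInd (P := fun C Y U V => (∀ i, G.b i ∉ U) → TWD G.G (fun X => X.card ≤ M) C U)
    ?_ ?_ ?_ ?_ ?_ ?_ d
  · intro _; exact .leaf
  · intro C U Y V v ih h1 h2 h3 _ hb
    exact .intro v (ih hb) h1 h2 (okT_iff.1 h3).2
  · intro C U Y V v ih h1 h2 h3 _ hb
    exact ih hb
  · intro C U Y V v ih h1 h2 _ h3 h4 _ hb
    refine .forget v (ih (fun i hi => hb i (by simp [hi]))) h1 ?_
    intro u hu
    exact h3 u ((TWGlue.ll _ _ _ _).2 (Or.inl hu))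
  · intro C U Y V v ih h1 h2 h3 h4 _ hb
    exact ih hb
  · intro C U₁ U₂ Y V₁ V₂ ih1 ih2 d1 d2 hU hV hb
    exact .join (ih1 (fun i hi => hb i (by simp [hi]))) (ih2 (fun i hi => hb i (by simp [hi]))) hU

theorem card_tr_le (G : BGraph t) (C : Finset G.V) : (tr G C).card ≤ C.card := by
  refine Finset.card_le_card_of_injOn G.b ?_ G.binj.injOn
  intro i hi
  exact mem_tr.1 hi

/-- no boundary vertex forgotten: right part. -/
theorem L0b {G H : BGraph t} {m M : ℕ} (G' : BGraph t) {C U : Finset G.V} {Y V : Finset H.I}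
    (d : TWD (glue G H) (okT G H m M) (C.disjSum Y) (U.disjSum V)) (hb : ∀ i, G.b i ∉ U) :
    TWD (glue G' H) (fun X => X.card ≤ m) (((tr G C).image G'.b).disjSum Y)
      ((∅ : Finset G'.V).disjSum V) := by
  revert hb
  refine dInd (P := fun C Y U V => (∀ i, G.b i ∉ U) → TWD (glue G' H) (fun X => X.card ≤ m)
    (((tr G C).image G'.b).disjSum Y) ((∅ : Finset G'.V).disjSum V)) ?_ ?_ ?_ ?_ ?_ ?_ d
  · intro _; simpa [tr] using TWD.leaf
  · intro C U Y V v ih h1 h2 h3 _ hb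
    by_cases hv : v ∈ Set.range G.b
    · obtain ⟨i, rfl⟩ := hv
      have hc := card_tr_le G (insert (G.b i) C)
      have hc2 := Finset.card_image_le (s := tr G (insert (G.b i) C)) (f := G'.b)
      rw [tr_insert_b, Finset.image_insert] at *
      refine dIntroL _ (ih hb) ?_ (by simp) ?_
      · simp [mem_tr, G'.binj.eq_iff, h1]
      · have := (okT_iff.1 h3).1
        rw [Finset.card_disjSum]
        omega
    · rw [tr_insert _ hv]; exact ih hb
  · intro C U Y V v ih h1 h2 h3 _ hb
    refine dIntroR _ (ih hb) h1 h2 ?_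
    have := (okT_iff.1 h3).1
    have hc := card_tr_le G C
    have hc2 := Finset.card_image_le (s := tr G C) (f := G'.b)
    rw [Finset.card_disjSum]
    omega
  · intro C U Y V v ih h1 h2 _ h3 h4 _ hb
    have hv : v ∉ Set.range G.b := by
      rintro ⟨i, rfl⟩; exact hb i (by simp)
    have := ih (fun i hi => hb i (by simp [hi]))
    rwa [tr_insert _ hv] at this
  · intro C U Y V v ih h1 h2 h3 h4 _ hb
    refine dForgetR _ (ih hb) h1 ?_ ?_
    · intro u hu
      obtain ⟨i, rfl, hi⟩ := (TWGlue.rl _ _ _ _).1 hu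
      have := h3 (G.b i) ((TWGlue.rl _ _ _ _).2 ⟨i, rfl, hi⟩)
      have h5 := hb i
      simp only [Finset.mem_union, h5, or_false] at this
      simp [mem_tr, G'.binj.eq_iff, this]
    · intro u hu
      exact h4 u ((TWGlue.rr _ _ _ _).2 ((TWGlue.rr _ _ _ _).1 hu))
  · intro C U₁ U₂ Y V₁ V₂ ih1 ih2 d1 d2 hU hV hb
    have := dJoin (ih1 (fun i hi => hb i (by simp [hi]))) (ih2 (fun i hi => hb i (by simp [hi])))
      (Finset.disjoint_empty_left _) hV
    simpa using this

/-- L0b extended to a larger bag -/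
theorem L0c {G H : BGraph t} {m M : ℕ} {G' : BGraph t} {C U : Finset G.V} {Y V : Finset H.I}
    (d : TWD (glue G H) (okT G H m M) (C.disjSum Y) (U.disjSum V)) (hb : ∀ i, G.b i ∉ U)
    {C' : Finset G'.V} (hC : tr G' C' = tr G C) (hc : C'.card + Y.card ≤ m) :
    TWD (glue G' H) (fun X => X.card ≤ m) (C'.disjSum Y) ((∅ : Finset G'.V).disjSum V) := by
  refine (L0b G' d hb).intros (fun X Y h h' => (Finset.card_le_card h).trans h') _
    ?_ ?_ (by rwa [Finset.card_disjSum])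
  · refine Finset.disjSum_mono_left _ ?_
    intro x hx
    obtain ⟨i, hi, rfl⟩ := Finset.mem_image.1 hx
    rw [← hC, mem_tr] at hi
    exact hi
  · rintro (x | x) hx
    · simp
    · have := dDisjR d x (by simpa using hx)
      simpa using this

end TWLink

namespace TWLink

open TWFam

variable {t : ℕ}

/-- soundness -/
def Sound (H : BGraph t) (m : ℕ) (Φ : Fam t) (Y V : Finset H.I) : Prop :=
  ∀ G' C' U', Φ G' C' U' →
    TWD (glue G' H) (fun X => X.card ≤ m) (C'.disjSum Y) (U'.disjSum V)

/-- traces -/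
def Trc (Φ : Fam t) (σ τ : Finset (Fin t)) : Prop :=
  ∀ G' C' U', Φ G' C' U' → tr G' C' = σ ∧ tr G' U' = τ

/-- the link -/
def Lnk (G H : BGraph t) (m M : ℕ) (C : Finset G.V) (Y : Finset H.I) (U : Finset G.V)
    (V : Finset H.I) : Prop :=
  ∃ Φ ∈ Lev t M (2 * (tr G U).card + (tr G C).card), Φ G C U ∧ Sound H m Φ Y V ∧
    Trc Φ (tr G C) (tr G U) ∧ Cl M (min M (m - Y.card)) Φ ≤ Φ

theorem trc_cl {M c : ℕ} {Φ : Fam t} {σ τ : Finset (Fin t)}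
    (h : ∀ G' C' U', Φ G' C' U' → C'.card ≤ c → tr G' C' = σ ∧ tr G' U' = τ) :
    Trc (Cl M c Φ) σ τ := by
  intro G' C' U' h'
  have h1 : ClP M G' c (fun C U => Φ G' C U ∧ C.card ≤ c) C' U' :=
    ClP.map le_rfl (fun C U h1 h2 => .base ⟨h2, h1⟩ h1) h'
  exact h1.trace (fun C U hh => h G' C U hh.1 hh.2)

/-- build a link by closure -/
theorem mk {G H : BGraph t} {m M : ℕ} (hM : M ≤ m) {C U : Finset G.V} {Y V : Finset H.I}
    (hC : C.card + Y.card ≤ m ∧ C.card ≤ M) (Φ : Fam t)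
    (hL : Φ ∈ Lev t M (2 * (tr G U).card + (tr G C).card)) (hΦ : Φ G C U)
    (hS : ∀ G' C' U', Φ G' C' U' → C'.card + Y.card ≤ m →
      TWD (glue G' H) (fun X => X.card ≤ m) (C'.disjSum Y) (U'.disjSum V))
    (hT : Trc Φ (tr G C) (tr G U)) : Lnk G H m M C Y U V := by
  refine ⟨Cl M (min M (m - Y.card)) Φ, lev_cl (min_le_left _ _) hL, .base hΦ (by omega),
    ?_, ?_, ((sys M).idem _ _).le⟩
  · intro G' C' U' h
    refine sound_cl hM (c := min M (m - Y.card)) (by omega) ?_ h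
    intro C U h1 h2
    exact hS G' C U h1 (by omega)
  · exact trc_cl (fun G' C' U' h _ => hT G' C' U' h)

/-- the link when no boundary vertex is forgotten -/
theorem lnk0 {G H : BGraph t} {m M : ℕ} (hM : M ≤ m) {C U : Finset G.V} {Y V : Finset H.I}
    (d : TWD (glue G H) (okT G H m M) (C.disjSum Y) (U.disjSum V)) (hb : tr G U = ∅) :
    Lnk G H m M C Y U V := by
  have hb' : ∀ i, G.b i ∉ U := by
    intro i hi
    have := mem_tr.2 hi
    rw [hb] at this
    simp at this
  have hC := okT_of d
  refine ⟨Base M (tr G C) (min M (m - Y.card)), lev_base (min_le_left _ _) _ _,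
    ⟨L0a d hb', by omega, rfl⟩, ?_, ?_, base_closed (min_le_left _ _) _⟩
  · rintro G' C' U' ⟨h1, h2, h3⟩
    have hc : C'.card + Y.card ≤ m := by omega
    have := dJoin (embed (H := H) hM h1 Y hc) (L0c d hb' h3 hc) (Finset.disjoint_empty_right _)
      (Finset.disjoint_empty_left _)
    simpa using this
  · rintro G' C' U' ⟨h1, h2, h3⟩
    refine ⟨h3, ?_⟩
    rw [hb]
    ext i
    simp [mem_tr, h1.2 i]

theorem tr_pos {G : BGraph t} {U : Finset G.V} (h : tr G U ≠ ∅) : 1 ≤ (tr G U).card :=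
  Finset.card_pos.2 (Finset.nonempty_iff_ne_empty.2 h)

theorem mem_of_tr {G G' : BGraph t} {C U : Finset G.V} {C' U' : Finset G'.V}
    (h1 : tr G' C' = tr G C) (h2 : tr G' U' = tr G U) {i : Fin t} (h : G.b i ∈ C ∪ U) :
    G'.b i ∈ C' ∪ U' := by
  rw [Finset.mem_union, ← mem_tr, ← mem_tr] at h ⊢
  rwa [h1, h2]

theorem lnk_join {G H : BGraph t} {m M : ℕ} {C U₁ U₂ : Finset G.V}
    {Y V₁ V₂ : Finset H.I} (ih : Lnk G H m M C Y U₂ V₂)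
    (d : TWD (glue G H) (okT G H m M) (C.disjSum Y) (U₁.disjSum V₁)) (hb : tr G U₁ = ∅)
    (hU : Disjoint U₂ U₁) (hV : Disjoint V₂ V₁) : Lnk G H m M C Y (U₂ ∪ U₁) (V₂ ∪ V₁) := by
  have hb' : ∀ i, G.b i ∉ U₁ := by
    intro i hi
    have := mem_tr.2 hi
    rw [hb] at this
    simp at this
  have hC := okT_of d
  obtain ⟨Φ, hL, hΦ, hS, hT, hcl⟩ := ih
  have e : tr G (U₂ ∪ U₁) = tr G U₂ := by rw [tr_union, hb, Finset.union_empty]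
  refine ⟨Φ, by rwa [e], ?_, ?_, by rwa [e], hcl⟩
  · exact hcl _ _ _ (.pend (.base hΦ (by omega)) (L0a d hb') hU)
  · intro G' C' U' h
    have d' := hS _ _ _ h
    have hc := d'.isOk (by simp) (fun X Y h h' => (Finset.card_le_card h).trans h')
    rw [Finset.card_disjSum] at hc
    have := dJoin d' (L0c d hb' (hT _ _ _ h).1 hc) (Finset.disjoint_empty_right _) hV
    simpa using this

theorem link {G H : BGraph t} {m M : ℕ} (hM : M ≤ m) {C U : Finset G.V} {Y V : Finset H.I}
    (d : TWD (glue G H) (okT G H m M) (C.disjSum Y) (U.disjSum V)) :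
    Lnk G H m M C Y U V := by
  refine dInd (P := Lnk G H m M) ?_ ?_ ?_ ?_ ?_ ?_ d
  · exact lnk0 hM (by simpa using TWD.leaf) (by ext; simp [mem_tr])
  · intro C U Y V v ih h1 h2 h3 d
    by_cases hb : tr G U = ∅
    · exact lnk0 hM d hb
    have hc := okT_of d
    obtain ⟨Φ, hL, hΦ, hS, hT, hcl⟩ := ih
    by_cases hv : v ∈ Set.range G.b
    · obtain ⟨i, rfl⟩ := hv
      refine mk hM hc (IntroF i Φ) ?_ ⟨C, rfl, hΦ, h1, h2⟩ ?_ ?_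
      · rw [tr_insert_b, Finset.card_insert_of_notMem (by rwa [mem_tr])]
        exact lev_intro hL i
      · rintro G' C' U' ⟨C'', rfl, h5, h6, h7⟩ h8
        exact dIntroL _ (hS _ _ _ h5) h6 h7 (by rwa [Finset.card_disjSum])
      · rintro G' C' U' ⟨C'', rfl, h5, h6, h7⟩
        have := hT _ _ _ h5
        rw [tr_insert_b, tr_insert_b, this.1, this.2]
        exact ⟨rfl, rfl⟩
    · refine ⟨Φ, ?_, ?_, hS, ?_, hcl⟩
      · rwa [tr_insert _ hv]
      · refine hcl _ _ _ (.intro v (.base hΦ ?_) h1 h2 hv ?_)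
        · have := Finset.card_le_card (Finset.subset_insert v C)
          omega
        · omega
      · rwa [tr_insert _ hv]
  · intro C U Y V v ih h1 h2 h3 d
    by_cases hb : tr G U = ∅
    · exact lnk0 hM d hb
    have hc := okT_of d
    obtain ⟨Φ, hL, hΦ, hS, hT, hcl⟩ := ih
    refine mk hM hc Φ hL hΦ ?_ hT
    intro G' C' U' h5 h6
    exact dIntroR _ (hS _ _ _ h5) h1 h2 (by rwa [Finset.card_disjSum])
  · intro C U Y V v ih h1 h2 d0 hl hr d
    by_cases hb : tr G (insert v U) = ∅
    · exact lnk0 hM d hb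
    have hc := okT_of d
    obtain ⟨Φ, hL, hΦ, hS, hT, hcl⟩ := ih
    by_cases hv : v ∈ Set.range G.b
    · obtain ⟨i, rfl⟩ := hv
      refine mk hM hc (ForgetF i Φ) ?_ ⟨U, rfl, hΦ, h1, ?_⟩ ?_ ?_
      · rw [tr_insert_b, Finset.card_insert_of_notMem (by rwa [mem_tr])] at *
        refine lev_mono M ?_ (lev_forget hL i)
        omega
      · intro u hu
        exact hl u ((TWGlue.ll _ _ _ _).2 (Or.inl hu))
      · rintro G' C' U' ⟨U'', rfl, h5, h6, h7⟩ h8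
        have hT' := hT _ _ _ h5
        refine dForgetL _ (hS _ _ _ h5) h6 ?_ ?_
        · intro u hu
          rcases (TWGlue.ll _ _ _ _).1 hu with h | ⟨i', j, e1, rfl, h⟩
          · exact h7 u h
          · have e := G'.binj e1
            subst e
            have h9 := hl (G.b j) ((TWGlue.ll _ _ _ _).2 (Or.inr ⟨i, j, rfl, rfl, h⟩))
            have hne : i ≠ j := fun e => h.ne (by rw [e])
            have h10 := mem_of_tr hT'.1 hT'.2 (i := j) (by
              rw [Finset.mem_union] at h9 ⊢
              rw [Finset.mem_insert]
              tauto)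
            rw [Finset.mem_union, Finset.mem_insert] at h10
            rw [Finset.mem_union]
            rcases h10 with (h10 | h10) | h10
            · exact absurd (G'.binj h10).symm hne
            · exact Or.inl h10
            · exact Or.inr h10
        · intro u hu
          obtain ⟨i', e1, h⟩ := (TWGlue.lr _ _ _ _).1 hu
          have e := G'.binj e1
          subst e
          exact hr u ((TWGlue.lr _ _ _ _).2 ⟨i, rfl, h⟩)
      · rintro G' C' U' ⟨U'', rfl, h5, h6, h7⟩
        have := hT _ _ _ h5
        rw [tr_insert_b, tr_insert_b] at this
        rw [tr_insert_b, tr_insert_b, this.2]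
        refine ⟨?_, rfl⟩
        have h8 : i ∉ tr G' C' := by rwa [mem_tr]
        have h9 : i ∉ tr G C := by rwa [mem_tr]
        rw [← Finset.erase_insert h8, this.1, Finset.erase_insert h9]
    · rw [tr_insert _ hv] at hb
      refine ⟨Φ, ?_, ?_, hS, ?_, hcl⟩
      · rw [tr_insert _ hv] at hL ⊢; exact hL
      · refine hcl _ _ _ (.forget v ?_ h1 hv ?_)
        · exact .base hΦ (by have := okT_of d0; omega)
        · intro u hu
          exact hl u ((TWGlue.ll _ _ _ _).2 (Or.inl hu))
      · rw [tr_insert _ hv] at hT ⊢; exact hT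
  · intro C U Y V v ih h1 h2 hl hr d
    by_cases hb : tr G U = ∅
    · exact lnk0 hM d hb
    have hc := okT_of d
    obtain ⟨Φ, hL, hΦ, hS, hT, hcl⟩ := ih
    refine mk hM hc Φ hL hΦ ?_ hT
    intro G' C' U' h5 h6
    have hT' := hT _ _ _ h5
    refine dForgetR _ (hS _ _ _ h5) h1 ?_ ?_
    · intro u hu
      obtain ⟨i, rfl, h⟩ := (TWGlue.rl _ _ _ _).1 hu
      exact mem_of_tr hT'.1 hT'.2 (hl (G.b i) ((TWGlue.rl _ _ _ _).2 ⟨i, rfl, h⟩))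
    · intro u hu
      exact hr u ((TWGlue.rr _ _ _ _).2 ((TWGlue.rr _ _ _ _).1 hu))
  · intro C U₁ U₂ Y V₁ V₂ ih1 ih2 d1 d2 hU hV
    have hc := okT_of d1
    by_cases hb1 : tr G U₁ = ∅
    · rw [Finset.union_comm U₁, Finset.union_comm V₁]
      exact lnk_join ih2 d1 hb1 hU.symm hV.symm
    by_cases hb2 : tr G U₂ = ∅
    · exact lnk_join ih1 d2 hb2 hU hV
    obtain ⟨Φ, hL, hΦ, hS, hT, hcl⟩ := ih1
    obtain ⟨Φ', hL', hΦ', hS', hT', hcl'⟩ := ih2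
    have p1 := tr_pos hb1
    have p2 := tr_pos hb2
    refine mk hM hc (JoinF Φ Φ') ?_ ⟨U₁, U₂, rfl, hΦ, hΦ', hU⟩ ?_ ?_
    · have : (tr G (U₁ ∪ U₂)).card = (tr G U₁).card + (tr G U₂).card := by
        rw [tr_union, Finset.card_union_of_disjoint]
        rw [Finset.disjoint_left] at hU ⊢
        intro i hi hi'
        exact hU (mem_tr.1 hi) (mem_tr.1 hi')
      rw [this]
      refine lev_mono M ?_ (lev_join (n := 2 * max (tr G U₁).card (tr G U₂).card + (tr G C).card)
        (lev_mono M ?_ hL) (lev_mono M ?_ hL')) <;> omega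
    · rintro G' C' U' ⟨U₁', U₂', rfl, h5, h6, h7⟩ h8
      exact dJoin (hS _ _ _ h5) (hS' _ _ _ h6) h7 hV
    · rintro G' C' U' ⟨U₁', U₂', rfl, h5, h6, h7⟩
      have e1 := hT _ _ _ h5
      have e2 := hT' _ _ _ h6
      rw [tr_union, tr_union, e1.2, e2.2]
      exact ⟨e1.1, rfl⟩

end TWLink

namespace TWFinal

open TWFam TWLink

variable {t : ℕ}

/-- the type of a boundaried graph -/
def typ (N : ℕ) (G : BGraph t) : Set (ℕ × Fam t) :=
  {p | p.1 ≤ N ∧ p.2 ∈ Lev t p.1 (2 * t) ∧ p.2 G ∅ Finset.univ}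

theorem typ_finite (N : ℕ) (P : Set (BGraph t)) : (typ N '' P).Finite := by
  have hK : (⋃ M ∈ {M | M ≤ N}, (fun Φ => (M, Φ)) '' Lev t M (2 * t)).Finite :=
    (Set.finite_le_nat N).biUnion (fun M _ => (lev_finite M _).image _)
  refine hK.finite_subsets.subset ?_
  rintro s ⟨G, _, rfl⟩
  rintro ⟨M, Φ⟩ ⟨h1, h2, _⟩
  simp only [Set.mem_iUnion]
  exact ⟨M, h1, Φ, h2, rfl⟩

theorem transfer {w : ℕ} {G₁ G₂ H : BGraph t} (h₁ : TreewidthLE G₁.G (w : ℤ))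
    (ht : typ (3 * t + w + 1) G₁ = typ (3 * t + w + 1) G₂) {k : ℤ}
    (h : TreewidthLE (glue G₁ H) k) : TreewidthLE (glue G₂ H) k := by
  have hG := (TWTree.twd_of_tw h₁).2
  have e : ((w : ℤ) + 1).toNat = w + 1 := by omega
  rw [e] at hG
  obtain ⟨hk, d⟩ := TWTree.twd_of_tw h
  set m := (k + 1).toNat with hm
  have d := TWGlue.trunc G₁ H w m hG d
  have d : TWD (glue G₁ H) (okT G₁ H m (min (3 * t + w + 1) m))
      ((∅ : Finset G₁.V).disjSum ∅) ((Finset.univ : Finset G₁.V).disjSum Finset.univ) := by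
    have e1 : (∅ : Finset G₁.V).disjSum (∅ : Finset H.I) = ∅ := by simp
    have e2 : (Finset.univ : Finset G₁.V).disjSum (Finset.univ : Finset H.I) = Finset.univ := by
      ext x; rcases x with x | x <;> simp
    rw [e1, e2]
    refine d.mono ?_
    intro X hX
    exact ⟨hX.1, le_min hX.2 (Finset.card_toLeft_le.trans hX.1)⟩
  obtain ⟨Φ, hL, hΦ, hS, _⟩ := link (min_le_right _ _) d
  have c1 : (tr G₁ Finset.univ).card ≤ t := by
    simpa using Finset.card_le_univ (tr G₁ Finset.univ)
  have c2 : (tr G₁ ∅).card = 0 := by simp [tr]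
  have hmem : (min (3 * t + w + 1) m, Φ) ∈ typ (3 * t + w + 1) G₁ :=
    ⟨min_le_left _ _, lev_mono _ (by omega) hL, hΦ⟩
  rw [ht] at hmem
  have d2 := hS G₂ ∅ Finset.univ hmem.2.2
  have e1 : (∅ : Finset G₂.V).disjSum (∅ : Finset H.I) = ∅ := by simp
  have e2 : (Finset.univ : Finset G₂.V).disjSum (Finset.univ : Finset H.I) = Finset.univ := by
    ext x; rcases x with x | x <;> simp
  rw [e1, e2] at d2
  have := TWTree.tw_of_twd d2
  have e3 : (m : ℤ) - 1 = k := by omega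
  rwa [e3] at this

end TWFinal

/-- Treewidth has finite integer index on graphs of treewidth at most `w`. -/
theorem treewidth_finite_integer_index (t w : ℕ) :
    ∃ R : Set (BGraph t), R.Finite ∧
      ∀ G : BGraph t, TreewidthLE G.G (w : ℤ) → ∃ R₀ ∈ R, TWEquiv G R₀ := by
  obtain ⟨R, hR, hbij⟩ := Set.exists_subset_bijOn {G : BGraph t | TreewidthLE G.G (w : ℤ)}
    (TWFinal.typ (3 * t + w + 1))
  refine ⟨R, hbij.finite_iff_finite.2 (TWFinal.typ_finite _ _), ?_⟩
  intro G hG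
  obtain ⟨R₀, h0, e⟩ := hbij.surjOn ⟨G, hG, rfl⟩
  refine ⟨R₀, h0, 0, ?_⟩
  intro H k
  rw [add_zero]
  exact ⟨TWFinal.transfer hG e.symm, TWFinal.transfer (hR h0) e⟩
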